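/- arXiv:2010.01731 — 3 statements merged into one kernel-verified Lean document; each statement's English description precedes it below -/
import Mathlib

section
/- For every real s with s ≠ 0 and s not equal to any prime number, there exists a real constant G(s) such that for every real t, one has −(1/s)·∑_{p ≤ x} log|1 − s/p| − log log x − G(s) = O((log x)^{−t}) as x → ∞, where the sum is over primes p ≤ x. Moreover, for s = 1 (where log|1 − 1/p| = log(1 − 1/p) for every prime p) one has G(1) = γ, the Euler–Mascheroni constant. -/
open Filter

/-- The `n`-th term of the series `∑ n, ((s - 1) n ^ (-s) + (n + 1) ^ (1 - s) - n ^ (1 - s))`,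
which represents `(s - 1) ζ(s) - 1` in the half-plane `0 < re s`. -/
noncomputable def zetaTerm (n : ℕ) (s : ℂ) : ℂ :=
  (s - 1) * (n : ℂ) ^ (-s) + ((n : ℂ) + 1) ^ (1 - s) - (n : ℂ) ^ (1 - s)

lemma norm_natCast_cpow_sub_cpow_le {n : ℕ} (hn : 1 ≤ n) {s : ℂ} (hs : 0 < s.re) {y : ℝ}
    (hy : y ∈ Set.Icc (n : ℝ) (n + 1)) :
    ‖(y : ℂ) ^ (-s) - (n : ℂ) ^ (-s)‖ ≤ ‖s‖ * (n : ℝ) ^ (-s.re - 1) := by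
  have hn0 : (0 : ℝ) < n := by exact_mod_cast hn
  have key := norm_image_sub_le_of_norm_deriv_le_segment' (f := fun y : ℝ => (y : ℂ) ^ (-s))
    (f' := fun y : ℝ => -s * (y : ℂ) ^ (-s - 1)) (a := n) (b := n + 1)
    (C := ‖s‖ * (n : ℝ) ^ (-s.re - 1)) ?_ ?_ y hy
  · refine (by simpa using key : _ ≤ _).trans ?_
    have : y - n ≤ 1 := by linarith [hy.2]
    exact mul_le_of_le_one_right (by positivity) this
  · intro x hx
    have hx0 : 0 < x := hn0.trans_le hx.1
    refine HasDerivAt.hasDerivWithinAt ?_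
    have := hasDerivAt_ofReal_cpow_const' (x := x) hx0.ne' (r := -s - 1) (by
      intro h; apply_fun Complex.re at h; simp at h; linarith)
    have h2 := this.const_mul (-s)
    have hs0 : s ≠ 0 := by rintro rfl; simp at hs
    refine h2.congr_of_eventuallyEq (.of_forall fun y => ?_)
    simp only [show -s - 1 + 1 = -s by ring]
    field_simp
  · intro x hx
    have hx0 : 0 < x := hn0.trans_le hx.1
    rw [norm_mul, norm_neg, Complex.norm_cpow_eq_rpow_re_of_pos hx0]
    simp only [Complex.sub_re, Complex.neg_re, Complex.one_re]
    gcongr ?_ * ?_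
    exact Real.rpow_le_rpow_of_nonpos hn0 hx.1 (by linarith)

lemma norm_zetaTerm_le {n : ℕ} (hn : 1 ≤ n) {s : ℂ} (hs : 0 < s.re) :
    ‖zetaTerm n s‖ ≤ ‖s - 1‖ * (‖s‖ * (n : ℝ) ^ (-s.re - 1)) := by
  have hn0 : (0 : ℝ) < n := by exact_mod_cast hn
  by_cases hs1 : s = 1
  · simp [zetaTerm, hs1]
  have key := norm_image_sub_le_of_norm_deriv_le_segment'
    (f := fun y : ℝ => (s - 1) * (n : ℂ) ^ (-s) * y + (y : ℂ) ^ (1 - s))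
    (f' := fun y : ℝ => (s - 1) * (n : ℂ) ^ (-s) + (1 - s) * (y : ℂ) ^ (-s)) (a := n) (b := n + 1)
    (C := ‖s - 1‖ * (‖s‖ * (n : ℝ) ^ (-s.re - 1))) ?_ ?_ (n + 1) ⟨by linarith, le_rfl⟩
  · convert key using 1
    · congr 1
      simp only [zetaTerm]
      push_cast
      ring
    · ring
  · intro x hx
    have hx0 : 0 < x := hn0.trans_le hx.1
    refine HasDerivAt.hasDerivWithinAt ?_
    have h1 := (hasDerivAt_ofReal_cpow_const' (x := x) hx0.ne' (r := -s) (by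
      intro h; exact hs1 (by linear_combination -h))).const_mul (1 - s)
    have h3 : (1 : ℂ) - s ≠ 0 := fun h => hs1 (by linear_combination -h)
    have h2 := ((hasDerivAt_id x).ofReal_comp.const_mul ((s - 1) * (n : ℂ) ^ (-s))).add h1
    convert h2 using 1
    · ext y
      simp only [Pi.add_apply, id]
      rw [show -s + 1 = 1 - s by ring]
      field_simp
    · simp
  · intro x hx
    rw [show (s - 1) * (n : ℂ) ^ (-s) + (1 - s) * (x : ℂ) ^ (-s) =
      (s - 1) * -((x : ℂ) ^ (-s) - (n : ℂ) ^ (-s)) by ring, norm_mul, norm_neg]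
    gcongr
    exact norm_natCast_cpow_sub_cpow_le hn hs ⟨hx.1, hx.2.le⟩

lemma summable_succ_rpow {a : ℝ} (ha : a < -1) : Summable fun n : ℕ => ((n + 1 : ℕ) : ℝ) ^ a :=
  (summable_nat_add_iff 1).mpr (Real.summable_nat_rpow.mpr ha)

lemma summable_zetaTerm {s : ℂ} (hs : 0 < s.re) : Summable fun n : ℕ => zetaTerm (n + 1) s :=
  Summable.of_norm_bounded (((summable_succ_rpow (a := -s.re - 1) (by linarith)).mul_left _).mul_left _)
    fun n => norm_zetaTerm_le (by omega) hs

lemma sum_zetaTerm (N : ℕ) (s : ℂ) : ∑ n ∈ Finset.range N, zetaTerm (n + 1) s =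
    (s - 1) * ∑ n ∈ Finset.range N, ((n + 1 : ℕ) : ℂ) ^ (-s) + ((N : ℂ) + 1) ^ (1 - s) - 1 := by
  induction N with
  | zero => simp
  | succ N ih =>
    rw [Finset.sum_range_succ, ih, Finset.sum_range_succ, zetaTerm]
    push_cast
    ring

lemma riemannZeta₁_eq_of_one_lt {s : ℂ} (hs : 1 < s.re) :
    riemannZeta₁ s = 1 + ∑' n : ℕ, zetaTerm (n + 1) s := by
  have hs1 : s ≠ 1 := by rintro rfl; simp at hs
  have h1 : riemannZeta₁ s = (s - 1) * riemannZeta s := by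
    rw [riemannZeta_eq_inv_sub_mul hs1, mul_inv_cancel_left₀ (sub_ne_zero.mpr hs1)]
  have h2 := (summable_zetaTerm (by linarith : 0 < s.re)).hasSum.tendsto_sum_nat
  have h3 : Summable fun n : ℕ => ((n + 1 : ℕ) : ℂ) ^ (-s) := by
    have := (summable_nat_add_iff 1).mpr (Complex.summable_one_div_nat_cpow.mpr hs)
    simpa [Complex.cpow_neg] using this
  have h4 := h3.hasSum.tendsto_sum_nat
  have h5 : riemannZeta s = ∑' n : ℕ, ((n + 1 : ℕ) : ℂ) ^ (-s) := by
    rw [zeta_eq_tsum_one_div_nat_add_one_cpow hs]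
    simp [Complex.cpow_neg]
  rw [← h5] at h4
  have h6 : Tendsto (fun N : ℕ => ((N : ℂ) + 1) ^ (1 - s)) atTop (nhds 0) := by
    rw [tendsto_zero_iff_norm_tendsto_zero]
    have : ∀ N : ℕ, ‖((N : ℂ) + 1) ^ (1 - s)‖ = ((N : ℝ) + 1) ^ (-(s.re - 1)) := by
      intro N
      have : ((N : ℂ) + 1) = (((N : ℝ) + 1 : ℝ) : ℂ) := by push_cast; rfl
      rw [this, Complex.norm_cpow_eq_rpow_re_of_pos (by positivity)]
      simp
    simp_rw [this]
    exact (tendsto_rpow_neg_atTop (by linarith : 0 < s.re - 1)).comp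
      (tendsto_atTop_add_const_right _ _ tendsto_natCast_atTop_atTop)
  simp_rw [sum_zetaTerm] at h2
  have h7 := tendsto_nhds_unique h2 (((h4.const_mul (s - 1)).add h6).sub_const 1)
  rw [h7, h1]
  ring

lemma riemannZeta₁_eq {s : ℂ} (hs : 1 / 4 < s.re) :
    riemannZeta₁ s = 1 + ∑' n : ℕ, zetaTerm (n + 1) s := by
  set R : ℝ := ‖s‖ + 3
  set U : Set ℂ := {z | 1 / 4 < z.re} ∩ Metric.ball 0 R
  have hUo : IsOpen U := (isOpen_lt continuous_const Complex.continuous_re).inter Metric.isOpen_ball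
  have hUc : IsPreconnected U :=
    ((convex_halfSpace_re_gt _).inter (convex_ball _ _)).isPreconnected
  have hd : DifferentiableOn ℂ (fun z => ∑' n : ℕ, zetaTerm (n + 1) z) U := by
    refine Complex.differentiableOn_tsum_of_summable_norm
      (u := fun n : ℕ => (R + 1) * (R * ((n + 1 : ℕ) : ℝ) ^ (-(5 / 4) : ℝ)))
      (((summable_succ_rpow (by norm_num)).mul_left _).mul_left _) ?_ hUo ?_
    · intro n
      have h0 : ((n : ℂ) + 1) ≠ 0 := by exact_mod_cast Nat.succ_ne_zero n
      have h1 : ((n : ℂ) + 1 + 1) ≠ 0 := by exact_mod_cast Nat.succ_ne_zero (n + 1)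
      intro z hz
      apply DifferentiableAt.differentiableWithinAt
      unfold zetaTerm
      push_cast
      fun_prop (disch := simp [h0, h1])
    · intro n z hz
      have hz1 : 1 / 4 < z.re := hz.1
      have hz2 : ‖z‖ < R := by simpa using hz.2
      refine (norm_zetaTerm_le (by omega) (by linarith)).trans ?_
      have h1 : ‖z - 1‖ ≤ R + 1 := (norm_sub_le _ _).trans (by simp; linarith)
      gcongr ?_ * (?_ * ?_)
      exact Real.rpow_le_rpow_of_exponent_le (by exact_mod_cast Nat.succ_le_succ (Nat.zero_le n))
        (by linarith)
  have h2 : (2 : ℂ) ∈ U := ⟨by norm_num, by simp [R]; linarith [norm_nonneg s]⟩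
  have := AnalyticOnNhd.eqOn_of_preconnected_of_eventuallyEq
    (differentiable_riemannZeta₁.differentiableOn.analyticOnNhd hUo)
    ((hd.const_add 1).analyticOnNhd hUo) hUc h2 ?_
  · exact this ⟨hs, by simp [R]⟩
  · have : {z : ℂ | 1 < z.re} ∈ nhds (2 : ℂ) :=
      (isOpen_lt continuous_const Complex.continuous_re).mem_nhds (by simp)
    filter_upwards [this] with z hz
    exact riemannZeta₁_eq_of_one_lt hz

lemma exists_norm_riemannZeta_le {η : ℝ} (hη : 0 < η) (hη2 : η ≤ 1 / 2) :
    ∃ C : ℝ, 0 < C ∧ ∀ s : ℂ, 1 - η ≤ s.re → s.re ≤ 3 → 1 ≤ |s.im| →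
      ‖riemannZeta s‖ ≤ C * |s.im| ^ (2 * η) := by
  have hZ := summable_succ_rpow (a := -1 - η) (by linarith)
  set Z := ∑' n : ℕ, ((n + 1 : ℕ) : ℝ) ^ (-1 - η)
  have hZ0 : 0 ≤ Z := tsum_nonneg fun n => by positivity
  refine ⟨5 * Z + 2, by positivity, fun s h1 h3 ht => ?_⟩
  set t := |s.im|
  have ht0 : 0 < t := by linarith
  have hs1 : s ≠ 1 := by rintro rfl; simp [t] at ht; linarith
  have hs1' : s - 1 ≠ 0 := sub_ne_zero.mpr hs1
  set N := ⌊t⌋₊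
  have hN1 : (N : ℝ) ≤ t := Nat.floor_le ht0.le
  have hN2 : t ≤ (N : ℝ) + 1 := (Nat.lt_floor_add_one t).le
  have hsum := summable_zetaTerm (by linarith : 0 < s.re)
  have hform : riemannZeta s = ∑ n ∈ Finset.range N, ((n + 1 : ℕ) : ℂ) ^ (-s) +
      ((N : ℂ) + 1) ^ (1 - s) / (s - 1) + (∑' n : ℕ, zetaTerm (n + N + 1) s) / (s - 1) := by
    rw [riemannZeta_eq_inv_sub_mul hs1, riemannZeta₁_eq (by linarith),
      ← hsum.sum_add_tsum_nat_add N, sum_zetaTerm]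
    field_simp
    ring
  have e1 : ‖∑ n ∈ Finset.range N, ((n + 1 : ℕ) : ℂ) ^ (-s)‖ ≤ t ^ (2 * η) * Z := by
    refine (norm_sum_le _ _).trans ?_
    calc _ ≤ ∑ n ∈ Finset.range N, t ^ (2 * η) * ((n + 1 : ℕ) : ℝ) ^ (-1 - η) := by
          refine Finset.sum_le_sum fun n hn => ?_
          rw [Complex.norm_natCast_cpow_of_pos (by omega)]
          have hp : (0 : ℝ) < (n + 1 : ℕ) := by positivity
          have h1' : (1 : ℝ) ≤ (n + 1 : ℕ) := by exact_mod_cast Nat.succ_le_succ (Nat.zero_le n)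
          have hle : ((n + 1 : ℕ) : ℝ) ≤ t :=
            le_trans (by exact_mod_cast Finset.mem_range.mp hn) hN1
          calc ((n + 1 : ℕ) : ℝ) ^ (-s).re ≤ ((n + 1 : ℕ) : ℝ) ^ (2 * η + (-1 - η)) :=
                Real.rpow_le_rpow_of_exponent_le h1' (by simp; linarith)
            _ = ((n + 1 : ℕ) : ℝ) ^ (2 * η) * ((n + 1 : ℕ) : ℝ) ^ (-1 - η) := Real.rpow_add hp _ _
            _ ≤ _ := by gcongr
      _ ≤ _ := by
          rw [← Finset.mul_sum]
          gcongr
          exact hZ.sum_le_tsum _ fun n _ => by positivity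
  have hts : t ≤ ‖s - 1‖ := by
    simpa [t] using Complex.abs_im_le_norm (s - 1)
  have e2 : ‖((N : ℂ) + 1) ^ (1 - s) / (s - 1)‖ ≤ 2 * t ^ (2 * η) := by
    have : ((N : ℂ) + 1) = (((N : ℝ) + 1 : ℝ) : ℂ) := by push_cast; rfl
    rw [norm_div, this, Complex.norm_cpow_eq_rpow_re_of_pos (by positivity)]
    have h2t : (N : ℝ) + 1 ≤ 2 * t := by linarith
    calc _ ≤ ((N : ℝ) + 1) ^ (1 - s).re / 1 := by gcongr; linarith
      _ = ((N : ℝ) + 1) ^ (1 - s.re) := by simp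
      _ ≤ ((N : ℝ) + 1) ^ η := Real.rpow_le_rpow_of_exponent_le (by simp) (by linarith)
      _ ≤ (2 * t) ^ η := by gcongr
      _ = 2 ^ η * t ^ η := Real.mul_rpow (by norm_num) ht0.le
      _ ≤ 2 ^ (1 : ℝ) * t ^ (2 * η) := by
        gcongr
        · norm_num
        · linarith
        · linarith
      _ = _ := by simp
  have e3 : ‖(∑' n : ℕ, zetaTerm (n + N + 1) s) / (s - 1)‖ ≤ 4 * t ^ (2 * η) * Z := by
    rw [div_eq_mul_inv, ← tsum_mul_right]
    refine tsum_of_norm_bounded (g := fun n : ℕ => 4 * t ^ (2 * η) * ((n + 1 : ℕ) : ℝ) ^ (-1 - η))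
      (hZ.hasSum.mul_left _) fun n => ?_
    rw [norm_mul, norm_inv]
    have hs4 : ‖s‖ ≤ 4 * t := by
      refine (Complex.norm_le_abs_re_add_abs_im s).trans ?_
      rw [abs_of_nonneg (by linarith)]
      linarith
    have hp : (0 : ℝ) < (n + N + 1 : ℕ) := by positivity
    have hle : t ≤ (n + N + 1 : ℕ) := by push_cast; linarith [(Nat.cast_nonneg n : (0 : ℝ) ≤ n)]
    have hn1 : ((n + 1 : ℕ) : ℝ) ≤ (n + N + 1 : ℕ) := by exact_mod_cast (by omega)
    calc _ ≤ ‖s - 1‖ * (‖s‖ * ((n + N + 1 : ℕ) : ℝ) ^ (-s.re - 1)) * ‖s - 1‖⁻¹ := by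
          gcongr
          exact norm_zetaTerm_le (by omega) (by linarith)
      _ = ‖s‖ * ((n + N + 1 : ℕ) : ℝ) ^ (-s.re - 1) := by
          have := norm_ne_zero_iff.mpr hs1'
          field_simp
      _ ≤ (4 * t) * ((n + N + 1 : ℕ) : ℝ) ^ ((-1 + 2 * η) + (-1 - η)) := by
          gcongr
          · linarith
          · linarith
      _ = 4 * t * (((n + N + 1 : ℕ) : ℝ) ^ (-1 + 2 * η) * ((n + N + 1 : ℕ) : ℝ) ^ (-1 - η)) := by
          rw [Real.rpow_add hp]
      _ ≤ 4 * t * (t ^ (-1 + 2 * η) * ((n + 1 : ℕ) : ℝ) ^ (-1 - η)) := by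
          gcongr ?_ * (?_ * ?_)
          · exact Real.rpow_le_rpow_of_nonpos ht0 hle (by linarith)
          · exact Real.rpow_le_rpow_of_nonpos (by positivity) hn1 (by linarith)
      _ = _ := by
          rw [Real.rpow_add ht0, Real.rpow_neg_one]
          field_simp
  rw [hform]
  refine (norm_add₃_le).trans ?_
  nlinarith [e1, e2, e3]

lemma abs_im_bounds_of_mem_closedBall {s z : ℂ} {r : ℝ} (hz : z ∈ Metric.closedBall s r) :
    |z.re - s.re| ≤ r ∧ |s.im| - r ≤ |z.im| ∧ |z.im| ≤ |s.im| + r := by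
  have hz' : ‖z - s‖ ≤ r := by simpa [dist_eq_norm] using hz
  have h1 : |z.re - s.re| ≤ r := by simpa using (Complex.abs_re_le_norm (z - s)).trans hz'
  have h2 : |z.im - s.im| ≤ r := by simpa using (Complex.abs_im_le_norm (z - s)).trans hz'
  have h3 := abs_sub_abs_le_abs_sub z.im s.im
  have h4 := abs_sub_abs_le_abs_sub s.im z.im
  rw [abs_sub_comm] at h4
  exact ⟨h1, by linarith, by linarith⟩

lemma two_mul_rpow_le {t a : ℝ} (ht : 0 ≤ t) (n : ℕ) (ha : a ≤ n) :
    (2 * t) ^ a ≤ 2 ^ n * t ^ a := by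
  rw [Real.mul_rpow (by norm_num) ht]
  gcongr
  rw [← Real.rpow_natCast]
  exact Real.rpow_le_rpow_of_exponent_le (by norm_num) ha

lemma exists_norm_deriv_riemannZeta_le {e : ℝ} (he : 0 < e) (he1 : e ≤ 1) :
    ∃ C : ℝ, 0 < C ∧ ∀ s : ℂ, 1 - e / 4 ≤ s.re → s.re ≤ 2 → 2 ≤ |s.im| →
      ‖deriv riemannZeta s‖ ≤ C * |s.im| ^ e := by
  obtain ⟨C, hC, h⟩ := exists_norm_riemannZeta_le (η := e / 2) (by linarith) (by linarith)
  refine ⟨C * 2 / (e / 4), by positivity, fun s h1 h2 ht => ?_⟩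
  have hmem : ∀ z ∈ Metric.closedBall s (e / 4), 1 - e / 2 ≤ z.re ∧ z.re ≤ 3 ∧ 1 ≤ |z.im| ∧
      |z.im| ≤ 2 * |s.im| := by
    intro z hz
    obtain ⟨a, b, c⟩ := abs_im_bounds_of_mem_closedBall hz
    rw [abs_le] at a
    refine ⟨?_, ?_, ?_, ?_⟩ <;> linarith
  have := Complex.norm_deriv_le_of_forall_mem_sphere_norm_le (f := riemannZeta) (c := s)
    (R := e / 4) (C := C * (2 * |s.im| ^ e)) (by linarith) ?_ ?_
  · refine this.trans (le_of_eq ?_)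
    ring
  · apply DifferentiableOn.diffContOnCl_ball (U := Metric.closedBall s (e / 4)) _ le_rfl
    intro z hz
    refine (differentiableAt_riemannZeta ?_).differentiableWithinAt
    rintro rfl
    have := (hmem _ hz).2.2.1
    norm_num at this
  · intro z hz
    obtain ⟨a, b, c, d⟩ := hmem z (Metric.sphere_subset_closedBall hz)
    refine (h z a b c).trans ?_
    gcongr
    rw [show 2 * (e / 2) = e by ring]
    calc |z.im| ^ e ≤ (2 * |s.im|) ^ e := by gcongr
      _ ≤ _ := by simpa using two_mul_rpow_le (abs_nonneg s.im) 1 (by simpa using he1)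

lemma one_le_norm_riemannZeta_product {x : ℝ} (hx : 0 < x) (y : ℝ) :
    1 ≤ ‖riemannZeta (1 + x)‖ ^ 3 * ‖riemannZeta (1 + x + Complex.I * y)‖ ^ 4 *
      ‖riemannZeta (1 + x + 2 * Complex.I * y)‖ := by
  have := DirichletCharacter.norm_LFunction_product_ge_one (1 : DirichletCharacter ℂ 1) hx y
  simpa [DirichletCharacter.LFunctionTrivChar, norm_mul, norm_pow] using this

lemma exists_norm_riemannZeta_ofReal_le :
    ∃ K : ℝ, 0 < K ∧ ∀ x : ℝ, 0 < x → x ≤ 1 → ‖riemannZeta (1 + x)‖ ≤ K / x := by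
  have hc : ContinuousOn (fun x : ℝ => riemannZeta₁ (1 + x)) (Set.Icc 0 1) :=
    (differentiable_riemannZeta₁.continuous.comp (by fun_prop)).continuousOn
  obtain ⟨K, hK⟩ := isCompact_Icc.exists_bound_of_continuousOn hc
  refine ⟨max K 1, by positivity, fun x hx hx1 => ?_⟩
  have h1 : (1 : ℂ) + x ≠ 1 := by simpa using hx.ne'
  rw [riemannZeta_eq_inv_sub_mul h1, norm_mul, add_sub_cancel_left, norm_inv, Complex.norm_real,
    Real.norm_of_nonneg hx.le, div_eq_inv_mul]
  gcongr
  exact (hK x ⟨hx.le, hx1⟩).trans (le_max_left _ _)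

lemma exists_le_norm_riemannZeta_pow_four {e : ℝ} (he : 0 < e) (he1 : e ≤ 1) :
    ∃ c : ℝ, 0 < c ∧ ∀ s : ℂ, 1 < s.re → s.re ≤ 2 → 2 ≤ |s.im| →
      c * (s.re - 1) ^ 3 * |s.im| ^ (-e) ≤ ‖riemannZeta s‖ ^ 4 := by
  obtain ⟨C, hC, h⟩ := exists_norm_riemannZeta_le (η := e / 2) (by linarith) (by linarith)
  obtain ⟨K, hK, hK'⟩ := exists_norm_riemannZeta_ofReal_le
  refine ⟨1 / (K ^ 3 * (2 * C)), by positivity, fun s h1 h2 ht => ?_⟩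
  set x := s.re - 1 with hx
  have hx0 : 0 < x := by linarith
  have ht0 : 0 < |s.im| := by linarith
  have key := one_le_norm_riemannZeta_product hx0 s.im
  have hs : (1 : ℂ) + x + Complex.I * s.im = s := by
    apply Complex.ext <;> simp [hx]
  rw [hs] at key
  have b1 := hK' x hx0 (by linarith)
  have b2 : ‖riemannZeta (1 + x + 2 * Complex.I * s.im)‖ ≤ 2 * C * |s.im| ^ e := by
    have him : |(1 + x + 2 * Complex.I * s.im : ℂ).im| = 2 * |s.im| := by simp [abs_mul]
    have hre : (1 + x + 2 * Complex.I * s.im : ℂ).re = s.re := by simp [hx]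
    have := h (1 + x + 2 * Complex.I * s.im) (by rw [hre]; linarith) (by rw [hre]; linarith)
      (by rw [him]; linarith)
    rw [him, show 2 * (e / 2) = e by ring] at this
    have h3 := two_mul_rpow_le (a := e) ht0.le 1 (by simpa using he1)
    calc _ ≤ _ := this
      _ ≤ C * (2 ^ 1 * |s.im| ^ e) := by gcongr
      _ = _ := by ring
  have key2 : 1 ≤ (K / x) ^ 3 * ‖riemannZeta s‖ ^ 4 * (2 * C * |s.im| ^ e) :=
    key.trans (by gcongr)
  rw [Real.rpow_neg ht0.le]
  have hp : 0 < |s.im| ^ e := by positivity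
  calc 1 / (K ^ 3 * (2 * C)) * x ^ 3 * (|s.im| ^ e)⁻¹
      ≤ 1 / (K ^ 3 * (2 * C)) * x ^ 3 * (|s.im| ^ e)⁻¹ *
        ((K / x) ^ 3 * ‖riemannZeta s‖ ^ 4 * (2 * C * |s.im| ^ e)) :=
        le_mul_of_one_le_right (by positivity) key2
    _ = _ := by field_simp

lemma exists_le_norm_riemannZeta {e : ℝ} (he : 0 < e) (he1 : e ≤ 1) :
    ∃ q c : ℝ, 0 < q ∧ q ≤ e / 4 ∧ 0 < c ∧ ∀ s : ℂ, 1 - q * |s.im| ^ (-(5 * e)) ≤ s.re →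
      s.re ≤ 2 → 2 ≤ |s.im| → c * |s.im| ^ (-(4 * e)) ≤ ‖riemannZeta s‖ := by
  obtain ⟨c0, hc0, h0⟩ := exists_le_norm_riemannZeta_pow_four he he1
  obtain ⟨C2, hC2, h2⟩ := exists_norm_deriv_riemannZeta_le he he1
  set c1 := min c0 1
  have hc1 : 0 < c1 := by positivity
  have hc14 : c1 ^ 4 ≤ c0 := by
    calc c1 ^ 4 ≤ c1 ^ 1 := pow_le_pow_of_le_one hc1.le (min_le_right _ _) (by norm_num)
      _ ≤ c0 := by rw [pow_one]; exact min_le_left _ _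
  set r := min (c1 / (4 * C2)) (e / 4)
  have hr : 0 < r := by positivity
  have hr1 : r ≤ e / 4 := min_le_right _ _
  have hrc : 4 * C2 * r ≤ c1 := by
    have : r ≤ c1 / (4 * C2) := min_le_left _ _
    rw [le_div_iff₀ (by positivity)] at this
    linarith
  have hr4 : r ^ 4 ≤ r := by
    simpa using pow_le_pow_of_le_one hr.le (by linarith : r ≤ 1) (by norm_num : 1 ≤ 4)
  refine ⟨r ^ 4, c1 * r ^ 3 / 2, by positivity, hr4.trans hr1, by positivity, fun s hs1 hs2 ht => ?_⟩
  have ht0 : 0 < |s.im| := by linarith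
  set u := |s.im| ^ (-e) with hu
  have hu0 : 0 < u := by positivity
  have hu1 : u ≤ 1 := Real.rpow_le_one_of_one_le_of_nonpos (by linarith) (by linarith)
  have hun : ∀ n : ℕ, |s.im| ^ (-(n * e)) = u ^ n := fun n => by
    rw [hu, ← Real.rpow_natCast, ← Real.rpow_mul ht0.le]
    ring_nf
  have h4 := hun 4
  have h5 := hun 5
  push_cast at h4 h5
  rw [h5] at hs1
  rw [h4]
  have hinv : |s.im| ^ e = u⁻¹ := by rw [hu, Real.rpow_neg ht0.le, inv_inv]
  have hu5 : u ^ 5 ≤ 1 := pow_le_one₀ hu0.le hu1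
  set d := r ^ 4 * u ^ 5 with hd
  have hd0 : 0 < d := by positivity
  have hd1 : d ≤ e / 4 := by
    calc d ≤ r ^ 4 * 1 := by rw [hd]; gcongr
      _ ≤ e / 4 := by linarith
  have big : ∀ z : ℂ, 1 + d ≤ z.re → z.re ≤ 2 → z.im = s.im → c1 * r ^ 3 * u ^ 4 ≤ ‖riemannZeta z‖ := by
    intro z hz1 hz2 hz
    have := h0 z (by linarith) hz2 (by rw [hz]; exact ht)
    rw [hz] at this
    refine le_of_pow_le_pow_left₀ (n := 4) (by norm_num) (norm_nonneg _) (le_trans ?_ this)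
    calc (c1 * r ^ 3 * u ^ 4) ^ 4 = c1 ^ 4 * d ^ 3 * u := by rw [hd]; ring
      _ ≤ c0 * (z.re - 1) ^ 3 * u := by
        gcongr
        linarith
  rcases le_total (1 + d) s.re with hcase | hcase
  · refine le_trans ?_ (big s hcase hs2 rfl)
    rw [div_mul_eq_mul_div]
    exact half_le_self (by positivity)
  · set z : ℂ := ⟨1 + d, s.im⟩ with hz
    have hb := big z le_rfl (by simp [hz]; linarith) rfl
    have hconv : Convex ℝ (Set.Icc (1 - d) (1 + d) ×ℂ {s.im}) :=
      ((convex_Icc (1 - d) (1 + d)).linear_preimage Complex.reLm).inter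
        ((convex_singleton s.im).linear_preimage Complex.imLm)
    have hdiff := hconv.norm_image_sub_le_of_norm_deriv_le (f := riemannZeta) (x := s) (y := z)
      (C := C2 * u⁻¹) ?_ ?_ ?_ ?_
    · have hzs : ‖z - s‖ ≤ 2 * d := by
        refine (Complex.norm_le_abs_re_add_abs_im _).trans ?_
        simp only [hz, Complex.sub_re, Complex.sub_im, sub_self, abs_zero, add_zero]
        rw [abs_of_nonneg] <;> linarith
      have h6 : ‖riemannZeta z - riemannZeta s‖ ≤ c1 * r ^ 3 / 2 * u ^ 4 := by
        calc _ ≤ C2 * u⁻¹ * (2 * d) := hdiff.trans (by gcongr)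
          _ = 4 * C2 * r * (r ^ 3 * u ^ 4 / 2) := by rw [hd]; field_simp; ring
          _ ≤ c1 * (r ^ 3 * u ^ 4 / 2) := by gcongr
          _ = _ := by ring
      have h7 := norm_sub_norm_le (riemannZeta z) (riemannZeta s)
      have h8 : c1 * r ^ 3 * u ^ 4 = 2 * (c1 * r ^ 3 / 2 * u ^ 4) := by ring
      linarith
    · intro w hw
      rw [Complex.mem_reProdIm] at hw
      refine differentiableAt_riemannZeta ?_
      rintro rfl
      have : s.im = 0 := by simpa using hw.2.symm
      simp [this] at ht0
    · intro w hw
      rw [Complex.mem_reProdIm] at hw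
      have him : w.im = s.im := hw.2
      have := h2 w (by linarith [hw.1.1]) (by linarith [hw.1.2]) (by rw [him]; exact ht)
      rwa [him, hinv] at this
    · exact ⟨⟨by linarith, by linarith⟩, rfl⟩
    · exact ⟨⟨by simp [hz]; linarith, by simp [hz]⟩, rfl⟩

/-- The negative logarithmic derivative of `ζ` minus `ζ`, continued holomorphically across `1`. -/
noncomputable def zetaLogDerivSub (s : ℂ) : ℂ :=
  -(deriv riemannZeta₁ s / riemannZeta₁ s) - riemannZeta₀ s

lemma riemannZeta₁_ne_zero_iff {s : ℂ} (hs : s ≠ 1) : riemannZeta₁ s ≠ 0 ↔ riemannZeta s ≠ 0 := by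
  rw [riemannZeta_eq_inv_sub_mul hs, mul_ne_zero_iff]
  simp [sub_ne_zero.mpr hs]

lemma riemannZeta₁_ne_zero_of_one_le {s : ℂ} (hs : 1 ≤ s.re) : riemannZeta₁ s ≠ 0 := by
  by_cases h : s = 1
  · simp [h]
  · exact (riemannZeta₁_ne_zero_iff h).mpr (riemannZeta_ne_zero_of_one_le_re hs)

lemma zetaLogDerivSub_eq {s : ℂ} (hs : s ≠ 1) (h : riemannZeta s ≠ 0) :
    zetaLogDerivSub s = -(deriv riemannZeta s / riemannZeta s) - riemannZeta s := by
  have h1 := sub_ne_zero.mpr hs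
  have h2 := (riemannZeta₁_ne_zero_iff hs).mpr h
  have h3 : riemannZeta₀ s = riemannZeta s - (s - 1)⁻¹ := by
    rw [riemannZeta_eq_inv_sub_add hs]; ring
  rw [zetaLogDerivSub, h3, deriv_riemannZeta_eq_neg_inv_sub_sq_mul_add hs,
    riemannZeta_eq_inv_sub_mul hs]
  field_simp
  ring

lemma analyticAt_zetaLogDerivSub {s : ℂ} (h : riemannZeta₁ s ≠ 0) :
    AnalyticAt ℂ zetaLogDerivSub s := by
  have h1 := differentiable_riemannZeta₁.analyticAt s
  exact ((h1.deriv.div h1 h).neg).sub (differentiable_riemannZeta₀.analyticAt s)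

lemma exists_norm_zetaLogDerivSub_le {e : ℝ} (he : 0 < e) (he1 : e ≤ 1) :
    ∃ q C : ℝ, 0 < q ∧ q ≤ e / 4 ∧ 0 < C ∧ ∀ s : ℂ, 1 - q * |s.im| ^ (-(5 * e)) ≤ s.re →
      s.re ≤ 2 → 2 ≤ |s.im| → riemannZeta₁ s ≠ 0 ∧ ‖zetaLogDerivSub s‖ ≤ C * |s.im| ^ (5 * e) := by
  obtain ⟨q, c, hq, hq', hc, h⟩ := exists_le_norm_riemannZeta he he1
  obtain ⟨C1, hC1, h1⟩ := exists_norm_riemannZeta_le (η := e / 2) (by linarith) (by linarith)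
  obtain ⟨C2, hC2, h2⟩ := exists_norm_deriv_riemannZeta_le he he1
  refine ⟨q, C2 / c + C1, hq, hq', by positivity, fun s hs1 hs2 ht => ?_⟩
  have ht1 : 1 ≤ |s.im| := by linarith
  have ht0 : 0 < |s.im| := by linarith
  have hle : |s.im| ^ (-(5 * e)) ≤ 1 :=
    Real.rpow_le_one_of_one_le_of_nonpos ht1 (by linarith)
  have hre : 1 - e / 4 ≤ s.re := by
    have : q * |s.im| ^ (-(5 * e)) ≤ q * 1 := by gcongr
    linarith
  have hlow := h s hs1 hs2 ht
  have hcpos : 0 < c * |s.im| ^ (-(4 * e)) := by positivity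
  have hz : riemannZeta s ≠ 0 := norm_pos_iff.mp (hcpos.trans_le hlow)
  have hs : s ≠ 1 := by rintro rfl; norm_num at ht
  refine ⟨(riemannZeta₁_ne_zero_iff hs).mpr hz, ?_⟩
  rw [zetaLogDerivSub_eq hs hz]
  have b1 := h1 s (by linarith) (by linarith) ht1
  rw [show 2 * (e / 2) = e by ring] at b1
  have b2 := h2 s hre hs2 ht
  calc _ ≤ ‖deriv riemannZeta s‖ / ‖riemannZeta s‖ + ‖riemannZeta s‖ := by
        refine (norm_sub_le _ _).trans ?_
        rw [norm_neg, norm_div]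
    _ ≤ (C2 * |s.im| ^ e) / (c * |s.im| ^ (-(4 * e))) + C1 * |s.im| ^ e := by gcongr
    _ = C2 / c * |s.im| ^ (5 * e) + C1 * |s.im| ^ e := by
        rw [Real.rpow_neg ht0.le, show 5 * e = e + 4 * e by ring, Real.rpow_add ht0]
        field_simp
    _ ≤ C2 / c * |s.im| ^ (5 * e) + C1 * |s.im| ^ (5 * e) := by
        gcongr
        linarith
    _ = _ := by ring

lemma exists_norm_iteratedDeriv_zetaLogDerivSub_le_of_three_le (k : ℕ) :
    ∃ C : ℝ, 0 < C ∧ ∀ s : ℂ, 1 ≤ s.re → s.re ≤ 3 / 2 → 3 ≤ |s.im| →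
      ‖iteratedDeriv k zetaLogDerivSub s‖ ≤ C * |s.im| ^ (1 / 2 : ℝ) := by
  set e : ℝ := 1 / (10 * (k + 1)) with he
  have he0 : 0 < e := by positivity
  have he1 : e ≤ 1 := by
    rw [he, div_le_one (by positivity)]
    have : (0 : ℝ) ≤ k := by positivity
    linarith
  obtain ⟨q, C, hq, hq', hC, h⟩ := exists_norm_zetaLogDerivSub_le he0 he1
  refine ⟨k.factorial * (C * 2 ^ 5) / (q / 2 ^ 5) ^ k, by positivity, fun s hs1 hs2 ht => ?_⟩
  have ht0 : 0 < |s.im| := by linarith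
  set v := |s.im| ^ (5 * e) with hv
  have hv1 : 1 ≤ v := Real.one_le_rpow (by linarith) (by linarith)
  have hv0 : 0 < v := by linarith
  set R := q / 2 ^ 5 * v⁻¹ with hR
  have hR0 : 0 < R := by positivity
  have hR1 : R ≤ 1 / 2 := by
    have : v⁻¹ ≤ 1 := inv_le_one_of_one_le₀ hv1
    calc R ≤ q / 2 ^ 5 * 1 := by rw [hR]; gcongr
      _ ≤ 1 / 2 := by norm_num; linarith
  have hmem : ∀ z ∈ Metric.closedBall s R, riemannZeta₁ z ≠ 0 ∧
      ‖zetaLogDerivSub z‖ ≤ C * 2 ^ 5 * v := by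
    intro z hz
    obtain ⟨a, b, c⟩ := abs_im_bounds_of_mem_closedBall hz
    rw [abs_le] at a
    have hz2 : 2 ≤ |z.im| := by linarith
    have hz0 : 0 < |z.im| := by linarith
    have hzt : |z.im| ≤ 2 * |s.im| := by linarith
    have hzv : |z.im| ^ (5 * e) ≤ 2 ^ 5 * v :=
      calc |z.im| ^ (5 * e) ≤ (2 * |s.im|) ^ (5 * e) := by gcongr
        _ ≤ _ := two_mul_rpow_le ht0.le 5 (by push_cast; linarith)
    have hRq : R ≤ q * |z.im| ^ (-(5 * e)) := by
      rw [hR, Real.rpow_neg hz0.le]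
      calc q / 2 ^ 5 * v⁻¹ = q * (2 ^ 5 * v)⁻¹ := by rw [mul_inv]; ring
        _ ≤ _ := by gcongr
    obtain ⟨p1, p2⟩ := h z (by linarith) (by linarith) hz2
    refine ⟨p1, p2.trans ?_⟩
    rw [mul_assoc]
    gcongr
  have := Complex.norm_iteratedDeriv_le_of_forall_mem_sphere_norm_le k (f := zetaLogDerivSub)
    (c := s) (R := R) (C := C * 2 ^ 5 * v) hR0 ?_ ?_
  · refine this.trans (le_of_eq ?_)
    have hvk : |s.im| ^ (1 / 2 : ℝ) = v ^ (k + 1) := by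
      rw [hv, ← Real.rpow_natCast, ← Real.rpow_mul ht0.le]
      congr 1
      rw [he]
      push_cast
      field_simp
      norm_num
    rw [hvk, hR, mul_pow, inv_pow]
    field_simp
    ring
  · apply DifferentiableOn.diffContOnCl_ball (U := Metric.closedBall s R) _ le_rfl
    intro z hz
    exact (analyticAt_zetaLogDerivSub (hmem z hz).1).differentiableAt.differentiableWithinAt
  · intro z hz
    exact (hmem z (Metric.sphere_subset_closedBall hz)).2

lemma exists_norm_iteratedDeriv_zetaLogDerivSub_le (k : ℕ) :
    ∃ C : ℝ, 0 < C ∧ ∀ s : ℂ, 1 ≤ s.re → s.re ≤ 3 / 2 →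
      ‖iteratedDeriv k zetaLogDerivSub s‖ ≤ C * (1 + |s.im|) ^ (1 / 2 : ℝ) := by
  obtain ⟨C, hC, h⟩ := exists_norm_iteratedDeriv_zetaLogDerivSub_le_of_three_le k
  have hcomp : IsCompact (Set.Icc (1 : ℝ) (3 / 2) ×ℂ Set.Icc (-3 : ℝ) 3) :=
    isCompact_Icc.reProdIm isCompact_Icc
  have hcont : ContinuousOn (iteratedDeriv k zetaLogDerivSub)
      (Set.Icc (1 : ℝ) (3 / 2) ×ℂ Set.Icc (-3 : ℝ) 3) := by
    intro z hz
    rw [Complex.mem_reProdIm] at hz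
    rw [iteratedDeriv_eq_iterate]
    exact ((analyticAt_zetaLogDerivSub
      (riemannZeta₁_ne_zero_of_one_le hz.1.1)).iterated_deriv k).continuousAt.continuousWithinAt
  obtain ⟨K, hK⟩ := hcomp.exists_bound_of_continuousOn hcont
  refine ⟨max K C, by positivity, fun s hs1 hs2 => ?_⟩
  rcases le_total 3 |s.im| with ht | ht
  · refine (h s hs1 hs2 ht).trans ?_
    gcongr
    · exact le_max_right _ _
    · linarith
  · refine (hK s ⟨⟨hs1, hs2⟩, abs_le.mp ht⟩).trans ((le_max_left K C).trans ?_)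
    exact le_mul_of_one_le_right (by positivity)
      (Real.one_le_rpow (by linarith [abs_nonneg s.im]) (by norm_num))

/-- The kernel `u ↦ 1 - u` on `(0, 1]`, extended by zero. -/
noncomputable def rieszKernel (t : ℝ) : ℂ :=
  Set.indicator (Set.Ioc 0 1) (fun _ => 1 : ℝ → ℂ) t -
    Set.indicator (Set.Ioc 0 1) (fun t => (t : ℂ) ^ (1 : ℂ) : ℝ → ℂ) t

lemma rieszKernel_of_pos {t : ℝ} (ht : 0 < t) : rieszKernel t = ((max (1 - t) 0 : ℝ) : ℂ) := by
  unfold rieszKernel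
  by_cases h : t ≤ 1
  · have : t ∈ Set.Ioc (0 : ℝ) 1 := ⟨ht, h⟩
    rw [Set.indicator_of_mem this, Set.indicator_of_mem this, max_eq_left (by linarith)]
    simp
  · have : t ∉ Set.Ioc (0 : ℝ) 1 := fun h' => h h'.2
    rw [Set.indicator_of_notMem this, Set.indicator_of_notMem this, max_eq_right (by linarith)]
    simp

lemma rieszKernel_zero : rieszKernel 0 = 0 := by simp [rieszKernel]

lemma hasMellin_rieszKernel {s : ℂ} (hs : 0 < s.re) :
    HasMellin rieszKernel s (1 / (s * (s + 1))) := by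
  have h1 := hasMellin_one_Ioc hs
  have h2 := hasMellin_cpow_Ioc 1 (s := s) (by simp; linarith)
  have h3 := hasMellin_sub h1.1 h2.1
  rw [h1.2, h2.2] at h3
  have hs0 : s ≠ 0 := by rintro rfl; simp at hs
  have hs1 : s + 1 ≠ 0 := by
    intro h
    have := congrArg Complex.re h
    simp at this
    linarith
  have : 1 / (s * (s + 1)) = 1 / s - 1 / (s + 1) := by field_simp; ring
  rw [this]
  exact h3

lemma norm_one_div_mul_succ_le {σ : ℝ} (hσ : 1 ≤ σ) (y : ℝ) :
    ‖(1 : ℂ) / ((σ + y * Complex.I) * (σ + y * Complex.I + 1))‖ ≤ 4 * (1 + |y|) ^ (-2 : ℝ) := by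
  have h1 : ∀ s : ℂ, 1 ≤ s.re → s.im = y → (1 + |y|) / 2 ≤ ‖s‖ := by
    intro s h1 h2
    have a := Complex.abs_re_le_norm s
    have b := Complex.abs_im_le_norm s
    rw [h2] at b
    have := le_abs_self s.re
    linarith
  have h2 := h1 (σ + y * Complex.I) (by simpa using hσ) (by simp)
  have h3 := h1 (σ + y * Complex.I + 1) (by simp; linarith) (by simp)
  have hp : 0 < 1 + |y| := by positivity
  rw [norm_div, norm_mul, norm_one, Real.rpow_neg hp.le]
  calc 1 / (‖(σ + y * Complex.I : ℂ)‖ * ‖(σ + y * Complex.I + 1 : ℂ)‖)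
      ≤ 1 / ((1 + |y|) / 2 * ((1 + |y|) / 2)) := by gcongr
    _ = _ := by
      norm_cast
      field_simp
      norm_num

lemma continuous_verticalLine (σ : ℝ) : Continuous fun y : ℝ => (σ + y * Complex.I : ℂ) := by
  fun_prop

lemma verticalLine_ne_zero {σ : ℝ} (hσ : 0 < σ) (y : ℝ) : (σ + y * Complex.I : ℂ) ≠ 0 := by
  intro h
  have := congrArg Complex.re h
  simp at this
  linarith

lemma verticalLine_add_one_ne_zero {σ : ℝ} (hσ : 0 < σ) (y : ℝ) :
    (σ + y * Complex.I + 1 : ℂ) ≠ 0 := by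
  intro h
  have := congrArg Complex.re h
  simp at this
  linarith

lemma integrable_one_div_mul_succ {σ : ℝ} (hσ : 1 ≤ σ) :
    MeasureTheory.Integrable
      fun y : ℝ => (1 : ℂ) / ((σ + y * Complex.I) * (σ + y * Complex.I + 1)) := by
  have h := integrable_one_add_norm (E := ℝ) (μ := MeasureTheory.volume) (r := 2) (by simp)
  refine (h.const_mul 4).mono' ?_ ?_
  · refine Continuous.aestronglyMeasurable ?_
    have := continuous_verticalLine σ
    refine continuous_const.div (by fun_prop) fun y => mul_ne_zero ?_ ?_
    · exact verticalLine_ne_zero (by linarith) y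
    · exact verticalLine_add_one_ne_zero (by linarith) y
  · exact Eventually.of_forall fun y => by simpa using norm_one_div_mul_succ_le hσ y

lemma rieszKernel_eq_integral {σ : ℝ} (hσ : 1 ≤ σ) {t : ℝ} (ht : 0 < t) :
    rieszKernel t = (1 / (2 * Real.pi) : ℝ) • ∫ y : ℝ, (t : ℂ) ^ (-(σ + y * Complex.I)) *
      (1 / ((σ + y * Complex.I) * (σ + y * Complex.I + 1))) := by
  have hm : ∀ y : ℝ, mellin rieszKernel (σ + y * Complex.I) =
      1 / ((σ + y * Complex.I) * (σ + y * Complex.I + 1)) := fun y =>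
    (hasMellin_rieszKernel (by simp; linarith)).2
  rw [← mellinInv_mellin_eq σ rieszKernel ht (hasMellin_rieszKernel (by simp; linarith)).1]
  · simp only [mellinInv, hm, smul_eq_mul]
  · unfold Complex.VerticalIntegrable
    simp only [hm]
    exact integrable_one_div_mul_succ hσ
  · have : rieszKernel =ᶠ[nhds t] fun t => ((max (1 - t) 0 : ℝ) : ℂ) := by
      filter_upwards [lt_mem_nhds ht] with u hu using rieszKernel_of_pos hu
    refine ContinuousAt.congr ?_ this.symm
    fun_prop

lemma sum_rieszKernel_eq (c : ℕ → ℂ) {x : ℝ} (hx : 0 < x) :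
    HasSum (fun n : ℕ => c n * rieszKernel (n / x))
      (∑ n ∈ Finset.Icc 1 ⌊x⌋₊, c n * (1 - n / x)) := by
  have h : ∀ n ∉ Finset.Icc 1 ⌊x⌋₊, c n * rieszKernel (n / x) = 0 := by
    intro n hn
    rcases Nat.eq_zero_or_pos n with rfl | h0
    · simp [rieszKernel_zero]
    · have h1 : ¬ n ≤ ⌊x⌋₊ := fun h => hn (Finset.mem_Icc.mpr ⟨h0, h⟩)
      rw [Nat.le_floor_iff hx.le, not_le] at h1
      have : 1 < n / x := by rwa [one_lt_div hx]
      rw [rieszKernel_of_pos (by positivity), max_eq_right (by linarith)]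
      simp
  have := hasSum_sum_of_ne_finset_zero (L := SummationFilter.unconditional ℕ) h
  convert this using 1
  refine Finset.sum_congr rfl fun n hn => ?_
  rw [Finset.mem_Icc, Nat.le_floor_iff hx.le] at hn
  have h0 : (0 : ℝ) < n := by exact_mod_cast hn.1
  have : n / x ≤ 1 := (div_le_one hx).mpr hn.2
  rw [rieszKernel_of_pos (by positivity), max_eq_left (by linarith)]
  push_cast
  ring

lemma term_verticalLine (c : ℕ → ℂ) {x : ℝ} (hx : 0 < x) {n : ℕ} (hn : n ≠ 0) (s : ℂ) :
    c n * ((n / x : ℝ) : ℂ) ^ (-s) = (x : ℂ) ^ s * LSeries.term c s n := by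
  have h := Complex.div_cpow_ofReal_nonneg n.cast_nonneg hx.le (-s)
  push_cast at h ⊢
  rw [LSeries.term_of_ne_zero hn, h, Complex.cpow_neg, Complex.cpow_neg, div_inv_eq_mul]
  ring

lemma sum_rieszKernel_eq_integral (c : ℕ → ℂ) {σ x : ℝ} (hσ : 1 ≤ σ) (hx : 0 < x)
    (hc : LSeriesSummable c σ) :
    ∑ n ∈ Finset.Icc 1 ⌊x⌋₊, c n * (1 - n / x) = (1 / (2 * Real.pi) : ℝ) •
      ∫ y : ℝ, (x : ℂ) ^ (σ + y * Complex.I : ℂ) * LSeries c (σ + y * Complex.I) *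
      (1 / ((σ + y * Complex.I) * (σ + y * Complex.I + 1))) := by
  rw [← (sum_rieszKernel_eq c hx).tsum_eq]
  set F : ℕ → ℝ → ℂ := fun n y => (x : ℂ) ^ (σ + y * Complex.I : ℂ) *
    LSeries.term c (σ + y * Complex.I) n *
      (1 / ((σ + y * Complex.I) * (σ + y * Complex.I + 1))) with hF
  have hnorm : ∀ n y, ‖F n y‖ = x ^ σ * ‖LSeries.term c σ n‖ *
      ‖(1 : ℂ) / ((σ + y * Complex.I) * (σ + y * Complex.I + 1))‖ := by
    intro n y
    rw [hF]
    simp only [norm_mul]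
    rw [Complex.norm_cpow_eq_rpow_re_of_pos hx, LSeries.norm_term_eq, LSeries.norm_term_eq]
    simp
  have hmeas : ∀ n, Continuous (F n) := by
    intro n
    have := continuous_verticalLine σ
    refine Continuous.mul (Continuous.mul ?_ ?_) ?_
    · exact this.const_cpow (Or.inl (by exact_mod_cast hx.ne'))
    · rcases eq_or_ne n 0 with rfl | hn
      · simpa using continuous_const
      · simp only [LSeries.term_of_ne_zero hn]
        refine continuous_const.div (this.const_cpow (Or.inl (by exact_mod_cast hn))) fun y => ?_
        simp [Complex.cpow_eq_zero_iff, hn]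
    · refine continuous_const.div (by fun_prop) fun y => mul_ne_zero ?_ ?_
      · exact verticalLine_ne_zero (by linarith) y
      · exact verticalLine_add_one_ne_zero (by linarith) y
  have hint : ∀ n, MeasureTheory.Integrable (F n) := fun n => by
    refine ((integrable_one_div_mul_succ hσ).norm.const_mul
      (x ^ σ * ‖LSeries.term c σ n‖)).mono' (hmeas n).aestronglyMeasurable ?_
    exact Eventually.of_forall fun y => (hnorm n y).le
  have hsum : Summable fun n => ∫ y, ‖F n y‖ := by
    simp only [hnorm, MeasureTheory.integral_const_mul]
    exact (hc.norm.mul_left _).mul_right _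
  have hkey := MeasureTheory.integral_tsum_of_summable_integral_norm hint hsum
  have hL : ∀ y : ℝ, ∑' n, F n y = (x : ℂ) ^ (σ + y * Complex.I : ℂ) *
      LSeries c (σ + y * Complex.I) * (1 / ((σ + y * Complex.I) * (σ + y * Complex.I + 1))) := by
    intro y
    rw [hF, LSeries]
    rw [tsum_mul_right, tsum_mul_left]
  simp only [hL] at hkey
  rw [← hkey, ← tsum_const_smul'']
  congr 1
  ext n
  rcases eq_or_ne n 0 with rfl | hn
  · simp [hF, rieszKernel_zero]
  · have hn0 : (0 : ℝ) < n := by positivity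
    rw [rieszKernel_eq_integral hσ (by positivity), mul_smul_comm, ← MeasureTheory.integral_const_mul]
    congr 2
    ext y
    rw [← mul_assoc, term_verticalLine c hx hn]

lemma exists_norm_sum_riesz_le : ∃ K : ℝ, 0 < K ∧ ∀ (c : ℕ → ℂ) (σ x B : ℝ), 1 ≤ σ → 0 < x →
    LSeriesSummable c σ →
    (∀ y : ℝ, ‖LSeries c (σ + y * Complex.I)‖ ≤ B * (1 + |y|) ^ (1 / 2 : ℝ)) →
    ‖∑ n ∈ Finset.Icc 1 ⌊x⌋₊, c n * (1 - n / x)‖ ≤ K * B * x ^ σ := by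
  have hI := integrable_one_add_norm (E := ℝ) (μ := MeasureTheory.volume) (r := 3 / 2)
    (by simp; norm_num)
  set I := ∫ y : ℝ, (1 + ‖y‖) ^ (-(3 / 2) : ℝ) with hIdef
  have hI0 : 0 ≤ I := MeasureTheory.integral_nonneg fun y => by positivity
  refine ⟨4 * I + 1, by positivity, fun c σ x B hσ hx hc hB => ?_⟩
  have hB0 : 0 ≤ B := by simpa using (norm_nonneg _).trans (hB 0)
  rw [sum_rieszKernel_eq_integral c hσ hx hc, norm_smul]
  have h1 : ‖∫ y : ℝ, (x : ℂ) ^ (σ + y * Complex.I : ℂ) * LSeries c (σ + y * Complex.I) *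
      (1 / ((σ + y * Complex.I) * (σ + y * Complex.I + 1)))‖ ≤
      ∫ y : ℝ, (x ^ σ * B * 4) * (1 + ‖y‖) ^ (-(3 / 2) : ℝ) := by
    refine MeasureTheory.norm_integral_le_of_norm_le (hI.const_mul _)
      (Eventually.of_forall fun y => ?_)
    have hre : (σ + y * Complex.I : ℂ).re = σ := by simp
    rw [norm_mul, norm_mul, Complex.norm_cpow_eq_rpow_re_of_pos hx, hre]
    have hp : 0 < 1 + |y| := by positivity
    calc _ ≤ x ^ σ * (B * (1 + |y|) ^ (1 / 2 : ℝ)) * (4 * (1 + |y|) ^ (-2 : ℝ)) := by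
          gcongr
          · exact hB y
          · exact norm_one_div_mul_succ_le hσ y
      _ = x ^ σ * B * 4 * ((1 + |y|) ^ (1 / 2 : ℝ) * (1 + |y|) ^ (-2 : ℝ)) := by ring
      _ = _ := by
        rw [← Real.rpow_add hp, Real.norm_eq_abs]
        norm_num
  rw [MeasureTheory.integral_const_mul, ← hIdef] at h1
  have h2 : ‖(1 / (2 * Real.pi) : ℝ)‖ ≤ 1 := by
    rw [Real.norm_of_nonneg (by positivity), div_le_one (by positivity)]
    linarith [Real.pi_gt_three]
  have hxs : 0 < x ^ σ := by positivity
  calc _ ≤ 1 * (x ^ σ * B * 4 * I) := by gcongr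
    _ ≤ (4 * I + 1) * B * x ^ σ := by nlinarith [mul_nonneg hB0 hxs.le]

lemma iterate_logMul_apply (f : ℕ → ℂ) (k n : ℕ) :
    (LSeries.logMul^[k] f) n = Complex.log n ^ k * f n := by
  induction k with
  | zero => simp
  | succ k ih => rw [Function.iterate_succ_apply', LSeries.logMul, ih]; ring

lemma abscissa_vonMangoldt_sub_one_le :
    LSeries.abscissaOfAbsConv (fun n => (ArithmeticFunction.vonMangoldt n : ℂ) - 1) ≤ 1 := by
  refine LSeries.abscissaOfAbsConv_le_of_forall_lt_LSeriesSummable' fun y hy => ?_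
  have hy' : 1 < (y : ℂ).re := by exact_mod_cast hy
  exact (ArithmeticFunction.LSeriesSummable_vonMangoldt hy').sub
    (LSeriesSummable_one_iff.mpr hy')

lemma LSeries_vonMangoldt_sub_one {s : ℂ} (hs : 1 < s.re) :
    LSeries (fun n => (ArithmeticFunction.vonMangoldt n : ℂ) - 1) s = zetaLogDerivSub s := by
  have h1 := ArithmeticFunction.LSeriesSummable_vonMangoldt hs
  have h2 := LSeriesSummable_one_iff.mpr hs
  have hs1 : s ≠ 1 := by rintro rfl; simp at hs
  have := LSeries_sub h1 h2
  rw [zetaLogDerivSub_eq hs1 (riemannZeta_ne_zero_of_one_lt_re hs), ← neg_div,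
    ← ArithmeticFunction.LSeries_vonMangoldt_eq_deriv_riemannZeta_div hs,
    ← LSeries_one_eq_riemannZeta hs, ← this]
  rfl

lemma norm_LSeries_iterate_logMul {s : ℂ} (hs : 1 < s.re) (k : ℕ) :
    ‖LSeries (LSeries.logMul^[k] fun n => (ArithmeticFunction.vonMangoldt n : ℂ) - 1) s‖ =
      ‖iteratedDeriv k zetaLogDerivSub s‖ := by
  have hev : LSeries (fun n => (ArithmeticFunction.vonMangoldt n : ℂ) - 1) =ᶠ[nhds s]
      zetaLogDerivSub := by
    filter_upwards [(isOpen_lt continuous_const Complex.continuous_re).mem_nhds hs] with z hz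
    exact LSeries_vonMangoldt_sub_one hz
  rw [← hev.iteratedDeriv_eq k, LSeries_iteratedDeriv]
  · simp
  · exact abscissa_vonMangoldt_sub_one_le.trans_lt (by exact_mod_cast hs)

lemma exists_abs_sum_riesz_vonMangoldt_le (k : ℕ) : ∃ C : ℝ, 0 < C ∧ ∀ x : ℝ, Real.exp 2 ≤ x →
    |∑ n ∈ Finset.Icc 1 ⌊x⌋₊, (ArithmeticFunction.vonMangoldt n - 1) * Real.log n ^ k * (x - n)| ≤
      C * x ^ 2 := by
  obtain ⟨K, hK, h⟩ := exists_norm_sum_riesz_le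
  obtain ⟨B, hB, h'⟩ := exists_norm_iteratedDeriv_zetaLogDerivSub_le k
  refine ⟨K * B * Real.exp 1, by positivity, fun x hx => ?_⟩
  have hx0 : 0 < x := (Real.exp_pos 2).trans_le hx
  have hlog : 2 ≤ Real.log x := by rwa [Real.le_log_iff_exp_le hx0]
  have hlog0 : 0 < Real.log x := by linarith
  set σ := 1 + 1 / Real.log x with hσ
  have hσ1 : 1 < σ := by rw [hσ]; linarith [one_div_pos.mpr hlog0]
  have hσ2 : σ ≤ 3 / 2 := by
    have : 1 / Real.log x ≤ 1 / 2 := by gcongr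
    linarith
  have hxσ : x ^ σ = Real.exp 1 * x := by
    rw [hσ, Real.rpow_add hx0, Real.rpow_one, Real.rpow_def_of_pos hx0,
      mul_one_div_cancel hlog0.ne', mul_comm]
  set c := LSeries.logMul^[k] fun n => (ArithmeticFunction.vonMangoldt n : ℂ) - 1 with hc
  have h1 := h c σ x B hσ1.le hx0 ?_ ?_
  · have h2 : ((∑ n ∈ Finset.Icc 1 ⌊x⌋₊,
        (ArithmeticFunction.vonMangoldt n - 1) * Real.log n ^ k * (x - n) : ℝ) : ℂ) =
        x * ∑ n ∈ Finset.Icc 1 ⌊x⌋₊, c n * (1 - n / x) := by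
      push_cast
      rw [Finset.mul_sum]
      refine Finset.sum_congr rfl fun n _ => ?_
      have hx' : (x : ℂ) ≠ 0 := by exact_mod_cast hx0.ne'
      rw [hc, iterate_logMul_apply, ← Complex.natCast_log]
      field_simp
    rw [← Real.norm_eq_abs, ← Complex.norm_real, h2, norm_mul, Complex.norm_real,
      Real.norm_of_nonneg hx0.le]
    rw [hxσ] at h1
    calc _ ≤ x * (K * B * (Real.exp 1 * x)) := by gcongr
      _ = _ := by ring
  · refine LSeriesSummable_of_abscissaOfAbsConv_lt_re ?_
    rw [hc, LSeries.absicssaOfAbsConv_logPowMul]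
    exact abscissa_vonMangoldt_sub_one_le.trans_lt (by exact_mod_cast hσ1)
  · intro y
    have hre : (σ + y * Complex.I : ℂ).re = σ := by simp
    have him : (σ + y * Complex.I : ℂ).im = y := by simp
    rw [hc, norm_LSeries_iterate_logMul (by rw [hre]; exact hσ1)]
    simpa [hre, him] using h' (σ + y * Complex.I) (by rw [hre]; exact hσ1.le) (by rw [hre]; exact hσ2)

/-- Riesz means `∑_{n ≤ x} c n * (x - n)` of a sequence. -/
noncomputable def rieszSum (c : ℕ → ℝ) (x : ℝ) : ℝ := ∑ n ∈ Finset.Ioc 0 ⌊x⌋₊, c n * (x - n)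

lemma card_Ioc_floor_le {y z : ℝ} (hy : 0 ≤ y) (hyz : y ≤ z) :
    ((Finset.Ioc ⌊y⌋₊ ⌊z⌋₊).card : ℝ) ≤ z - y + 1 := by
  rw [Nat.card_Ioc, Nat.cast_sub (Nat.floor_mono hyz)]
  linarith [Nat.floor_le (hy.trans hyz), Nat.lt_floor_add_one y]

lemma le_rieszSum_sub {c : ℕ → ℝ} {y z L : ℝ} (hy : 0 ≤ y) (hyz : y ≤ z) (hL : 0 ≤ L)
    (hc : ∀ n : ℕ, n ≤ ⌊z⌋₊ → -L ≤ c n) :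
    (z - y) * ∑ n ∈ Finset.Ioc 0 ⌊y⌋₊, c n - (z - y) * (z - y + 1) * L ≤
      rieszSum c z - rieszSum c y := by
  have hfl := Nat.floor_mono hyz
  have hsplit := Finset.sum_Ioc_consecutive (fun n : ℕ => c n * (z - n)) (Nat.zero_le _) hfl
  have h1 : ∑ n ∈ Finset.Ioc 0 ⌊y⌋₊, c n * (z - n) =
      (z - y) * ∑ n ∈ Finset.Ioc 0 ⌊y⌋₊, c n + rieszSum c y := by
    rw [rieszSum, Finset.mul_sum, ← Finset.sum_add_distrib]
    exact Finset.sum_congr rfl fun n _ => by ring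
  have h2 : ∑ n ∈ Finset.Ioc ⌊y⌋₊ ⌊z⌋₊, -(L * (z - y)) ≤
      ∑ n ∈ Finset.Ioc ⌊y⌋₊ ⌊z⌋₊, c n * (z - n) := by
    refine Finset.sum_le_sum fun n hn => ?_
    rw [Finset.mem_Ioc] at hn
    have a := (Nat.floor_lt hy).mp hn.1
    have b := (Nat.le_floor_iff (hy.trans hyz)).mp hn.2
    nlinarith [hc n hn.2]
  rw [Finset.sum_const, nsmul_eq_mul] at h2
  have h3 := mul_le_mul_of_nonneg_right (card_Ioc_floor_le hy hyz)
    (mul_nonneg hL (sub_nonneg.mpr hyz))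
  rw [rieszSum, ← hsplit, h1]
  linarith

lemma rieszSum_sub_le {c : ℕ → ℝ} {y z L : ℝ} (hy : 0 ≤ y) (hyz : y ≤ z) (hL : 0 ≤ L)
    (hc : ∀ n : ℕ, n ≤ ⌊z⌋₊ → -L ≤ c n) :
    rieszSum c z - rieszSum c y ≤
      (z - y) * ∑ n ∈ Finset.Ioc 0 ⌊z⌋₊, c n + (z - y) * (z - y + 1) * L := by
  have hfl := Nat.floor_mono hyz
  have hsplit := Finset.sum_Ioc_consecutive (fun n : ℕ => c n * (y - n)) (Nat.zero_le _) hfl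
  have h1 : ∑ n ∈ Finset.Ioc 0 ⌊z⌋₊, c n * (y - n) =
      rieszSum c z - (z - y) * ∑ n ∈ Finset.Ioc 0 ⌊z⌋₊, c n := by
    rw [rieszSum, Finset.mul_sum, ← Finset.sum_sub_distrib]
    exact Finset.sum_congr rfl fun n _ => by ring
  have h2 : ∑ n ∈ Finset.Ioc ⌊y⌋₊ ⌊z⌋₊, c n * (y - n) ≤
      ∑ n ∈ Finset.Ioc ⌊y⌋₊ ⌊z⌋₊, (L * (z - y)) := by
    refine Finset.sum_le_sum fun n hn => ?_
    rw [Finset.mem_Ioc] at hn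
    have a := (Nat.floor_lt hy).mp hn.1
    have b := (Nat.le_floor_iff (hy.trans hyz)).mp hn.2
    nlinarith [hc n hn.2]
  rw [Finset.sum_const, nsmul_eq_mul] at h2
  have h3 := mul_le_mul_of_nonneg_right (card_Ioc_floor_le hy hyz)
    (mul_nonneg hL (sub_nonneg.mpr hyz))
  have h4 : rieszSum c y = ∑ n ∈ Finset.Ioc 0 ⌊y⌋₊, c n * (y - n) := rfl
  linarith

lemma exists_abs_sum_vonMangoldt_le (m : ℕ) : ∃ C : ℝ, 0 < C ∧ ∀ᶠ x : ℝ in atTop,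
    |∑ n ∈ Finset.Ioc 0 ⌊x⌋₊, (ArithmeticFunction.vonMangoldt n - 1) * Real.log n ^ (2 * m)| ≤
      C * (x * Real.log x ^ m) := by
  obtain ⟨C, hC, hW⟩ := exists_abs_sum_riesz_vonMangoldt_le (2 * m)
  set c : ℕ → ℝ := fun n => (ArithmeticFunction.vonMangoldt n - 1) * Real.log n ^ (2 * m) with hc
  have hW' : ∀ x : ℝ, Real.exp 2 ≤ x → |rieszSum c x| ≤ C * x ^ 2 := fun x hx => hW x hx
  have hc' : ∀ z : ℝ, 1 ≤ z → ∀ n : ℕ, n ≤ ⌊z⌋₊ → -(Real.log z ^ (2 * m)) ≤ c n := by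
    intro z hz n hn
    have hn' := (Nat.le_floor_iff (by linarith)).mp hn
    have h1 : Real.log n ^ (2 * m) ≤ Real.log z ^ (2 * m) := by
      rcases Nat.eq_zero_or_pos n with rfl | h0
      · simp only [Nat.cast_zero, Real.log_zero]
        gcongr
        exact Real.log_nonneg hz
      · gcongr
    have h2 : 0 ≤ ArithmeticFunction.vonMangoldt n := ArithmeticFunction.vonMangoldt_nonneg
    have h3 : 0 ≤ Real.log n ^ (2 * m) := by
      have := Real.log_natCast_nonneg n
      positivity
    simp only [hc]
    nlinarith [mul_nonneg h2 h3]
  refine ⟨10 * C + 2 ^ (2 * m), by positivity, ?_⟩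
  have hlo : ∀ᶠ x : ℝ in atTop, 2 * Real.log x ^ m ≤ x := by
    have := (Real.isLittleO_pow_log_id_atTop (n := m)).bound (show (0 : ℝ) < 1 / 2 by norm_num)
    filter_upwards [this, eventually_ge_atTop 1] with x hx hx1
    rw [id, Real.norm_of_nonneg (by linarith : (0 : ℝ) ≤ x)] at hx
    have := (le_abs_self _).trans hx
    linarith
  filter_upwards [hlo, eventually_ge_atTop (2 * Real.exp 2)] with x hx hx2
  have he := Real.add_one_le_exp (2 : ℝ)
  have hx0 : 0 < x := by linarith
  have hl1 : 1 ≤ Real.log x := by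
    rw [Real.le_log_iff_exp_le hx0]
    have := Real.exp_le_exp.mpr (show (1 : ℝ) ≤ 2 by norm_num)
    linarith
  set l := Real.log x with hl
  have hlm : 1 ≤ l ^ m := one_le_pow₀ hl1
  have hlm0 : 0 < l ^ m := by linarith
  set h := x / (2 * l ^ m) with hh
  have hh0 : 0 < h := by positivity
  have hh1 : 1 ≤ h := by rw [hh, le_div_iff₀ (by positivity)]; linarith
  have hhx : h ≤ x / 2 := by
    rw [hh]; gcongr; linarith
  set D := ∑ n ∈ Finset.Ioc 0 ⌊x⌋₊, c n
  set L := Real.log (x + h) ^ (2 * m) with hL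
  have hL2 : L ≤ 2 ^ (2 * m) * l ^ (2 * m) := by
    rw [hL, ← mul_pow]
    gcongr
    · exact Real.log_nonneg (by linarith)
    · calc Real.log (x + h) ≤ Real.log (x * x) := Real.log_le_log (by linarith) (by nlinarith)
        _ = 2 * l := by rw [Real.log_mul hx0.ne' hx0.ne']; ring
  have hL0 : 0 ≤ L := by have := Real.log_nonneg (show 1 ≤ x + h by linarith); positivity
  have hxh : x ^ 2 = 2 * l ^ m * x * h := by rw [hh]; field_simp
  have hLh : (h + 1) * L ≤ 2 ^ (2 * m) * (x * l ^ m) := by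
    calc (h + 1) * L ≤ (2 * h) * (2 ^ (2 * m) * l ^ (2 * m)) := by gcongr; linarith
      _ = _ := by rw [hh]; field_simp; ring
  have hup := le_rieszSum_sub (c := c) hx0.le (show x ≤ x + h by linarith) hL0
    (hc' _ (by linarith))
  have hlow := rieszSum_sub_le (c := c) (show 0 ≤ x - h by linarith) (show x - h ≤ x by linarith)
    hL0 (fun n hn => hc' (x + h) (by linarith) n (hn.trans (Nat.floor_mono (by linarith))))
  have w1 := abs_le.mp (hW' x (by linarith))
  have w2 := abs_le.mp (hW' (x + h) (by linarith))
  have w3 := abs_le.mp (hW' (x - h) (by linarith))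
  have q2 : C * (x + h) ^ 2 ≤ C * (4 * x ^ 2) := by gcongr; nlinarith
  have q3 : C * (x - h) ^ 2 ≤ C * (4 * x ^ 2) := by gcongr; nlinarith
  have e1 : x + h - x = h := by ring
  have e2 : x - (x - h) = h := by ring
  rw [e1] at hup
  rw [e2] at hlow
  have hfin : C * (5 * x ^ 2) + h * ((h + 1) * L) ≤
      h * ((10 * C + 2 ^ (2 * m)) * (x * l ^ m)) := by
    have := mul_le_mul_of_nonneg_left hLh hh0.le
    rw [hxh]
    linarith
  rw [abs_le]
  constructor
  · refine le_of_mul_le_mul_left (a := h) ?_ hh0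
    linarith
  · refine le_of_mul_le_mul_left (a := h) ?_ hh0
    linarith

/-- `log p` at primes `p` and zero elsewhere. -/
noncomputable def primeLog (n : ℕ) : ℝ := if n.Prime then Real.log n else 0

lemma sum_vonMangoldt_sub_primeLog_le (k : ℕ) {x : ℝ} (hx : 1 ≤ x) :
    |∑ n ∈ Finset.Ioc 0 ⌊x⌋₊, (ArithmeticFunction.vonMangoldt n - primeLog n) * Real.log n ^ k| ≤
      2 * √x * Real.log x * Real.log x ^ k := by
  have h0 : ∀ n : ℕ, 0 ≤ ArithmeticFunction.vonMangoldt n - primeLog n := by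
    intro n
    unfold primeLog
    split_ifs with h
    · rw [ArithmeticFunction.vonMangoldt_apply_prime h, sub_self]
    · simp
  rw [abs_of_nonneg (Finset.sum_nonneg fun n _ =>
    mul_nonneg (h0 n) (pow_nonneg (Real.log_natCast_nonneg n) k))]
  have h1 : ∑ n ∈ Finset.Ioc 0 ⌊x⌋₊, (ArithmeticFunction.vonMangoldt n - primeLog n) =
      Chebyshev.psi x - Chebyshev.theta x := by
    rw [Finset.sum_sub_distrib, Chebyshev.psi, Chebyshev.theta, Finset.sum_filter]
    rfl
  calc _ ≤ ∑ n ∈ Finset.Ioc 0 ⌊x⌋₊,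
        (ArithmeticFunction.vonMangoldt n - primeLog n) * Real.log x ^ k := by
        refine Finset.sum_le_sum fun n hn => ?_
        rw [Finset.mem_Ioc, Nat.le_floor_iff (by linarith)] at hn
        have hn0 : (0 : ℝ) < n := by exact_mod_cast hn.1
        have := h0 n
        have := Real.log_natCast_nonneg n
        gcongr
        exact hn.2
    _ = (Chebyshev.psi x - Chebyshev.theta x) * Real.log x ^ k := by
        rw [← Finset.sum_mul, h1]
    _ ≤ _ := by
        have := Real.log_nonneg hx
        gcongr
        exact Chebyshev.psi_sub_theta_le hx

lemma exists_abs_sum_primeLog_le (m : ℕ) : ∃ C : ℝ, 0 < C ∧ ∀ᶠ x : ℝ in atTop,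
    |∑ n ∈ Finset.Ioc 0 ⌊x⌋₊, (primeLog n - 1) * Real.log n ^ (2 * m)| ≤
      C * (x * Real.log x ^ m) := by
  obtain ⟨C, hC, h⟩ := exists_abs_sum_vonMangoldt_le m
  refine ⟨C + 2, by positivity, ?_⟩
  have hlo : ∀ᶠ x : ℝ in atTop, Real.log x ^ (m + 1) ≤ √x := by
    have := (Real.isLittleO_pow_log_id_atTop (n := 2 * (m + 1))).bound
      (show (0 : ℝ) < 1 by norm_num)
    filter_upwards [this, eventually_ge_atTop 1] with x hx hx1
    rw [id, Real.norm_of_nonneg (by linarith : (0 : ℝ) ≤ x)] at hx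
    refine Real.le_sqrt_of_sq_le ?_
    rw [← pow_mul, mul_comm (m + 1)]
    linarith [(le_abs_self _).trans hx]
  filter_upwards [h, hlo, eventually_ge_atTop 1] with x h1 h2 hx
  have h3 := sum_vonMangoldt_sub_primeLog_le (2 * m) hx
  have h4 : ∑ n ∈ Finset.Ioc 0 ⌊x⌋₊, (primeLog n - 1) * Real.log n ^ (2 * m) =
      ∑ n ∈ Finset.Ioc 0 ⌊x⌋₊, (ArithmeticFunction.vonMangoldt n - 1) * Real.log n ^ (2 * m) -
      ∑ n ∈ Finset.Ioc 0 ⌊x⌋₊, (ArithmeticFunction.vonMangoldt n - primeLog n) *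
        Real.log n ^ (2 * m) := by
    rw [← Finset.sum_sub_distrib]
    exact Finset.sum_congr rfl fun n _ => by ring
  have hl := Real.log_nonneg hx
  have h5 : 2 * √x * Real.log x * Real.log x ^ (2 * m) ≤ 2 * (x * Real.log x ^ m) :=
    calc 2 * √x * Real.log x * Real.log x ^ (2 * m)
        = 2 * √x * Real.log x ^ (m + 1) * Real.log x ^ m := by ring
      _ ≤ 2 * √x * √x * Real.log x ^ m := by gcongr
      _ = _ := by rw [mul_assoc 2, Real.mul_self_sqrt (by linarith)]; ring
  rw [h4]
  refine (abs_sub _ _).trans ?_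
  linarith

lemma hasDerivAt_inv_mul_log_pow (k : ℕ) {t : ℝ} (ht : 1 < t) :
    HasDerivAt (fun t : ℝ => (t * Real.log t ^ (k + 1))⁻¹)
      (-((Real.log t + (k + 1)) / (t ^ 2 * Real.log t ^ (k + 2)))) t := by
  have hl : 0 < Real.log t := Real.log_pos ht
  have ht0 : t ≠ 0 := by linarith
  have h1 := ((hasDerivAt_id t).mul ((Real.hasDerivAt_log ht0).pow (k + 1))).inv
    (by simp only [Pi.mul_apply, id, Pi.pow_apply]; positivity)
  refine h1.congr_deriv ?_
  simp only [id, Pi.mul_apply, Pi.pow_apply, Nat.add_sub_cancel]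
  push_cast
  field_simp
  ring

lemma hasDerivAt_neg_inv_log_pow (m : ℕ) {t : ℝ} (ht : 1 < t) :
    HasDerivAt (fun t : ℝ => -(Real.log t ^ (m + 1))⁻¹)
      ((m + 1) / (t * Real.log t ^ (m + 2))) t := by
  have hl : 0 < Real.log t := Real.log_pos ht
  have ht0 : t ≠ 0 := by linarith
  have h1 := (((Real.hasDerivAt_log ht0).pow (m + 1)).inv
    (by simp only [Pi.pow_apply]; positivity)).neg
  refine h1.congr_deriv ?_
  simp only [Pi.pow_apply, Nat.add_sub_cancel]
  push_cast
  field_simp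
  ring

lemma exists_abs_sum_primeLog_div_le (m : ℕ) : ∃ K : ℝ, 0 < K ∧ ∀ᶠ y : ℝ in atTop, ∀ z, y ≤ z →
    |∑ n ∈ Finset.Ioc ⌊y⌋₊ ⌊z⌋₊, (primeLog n - 1) / (n * Real.log n)| ≤
      K * (Real.log y ^ (m + 1))⁻¹ := by
  obtain ⟨C, hC, h⟩ := exists_abs_sum_primeLog_le (m + 1)
  obtain ⟨X, hX⟩ := eventually_atTop.mp h
  set M := 2 * (m + 1) with hM
  refine ⟨2 * C + C * (M + 2), by positivity, ?_⟩
  filter_upwards [eventually_ge_atTop X, eventually_ge_atTop (Real.exp 1)] with y hyX hye z hyz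
  have he : 1 < Real.exp 1 := by simp
  have hlog : ∀ t, y ≤ t → 1 ≤ Real.log t := fun t ht => by
    rw [Real.le_log_iff_exp_le (by linarith)]
    linarith
  set c : ℕ → ℝ := fun n => (primeLog n - 1) * Real.log n ^ M with hc
  set D : ℝ → ℝ := fun x => ∑ n ∈ Finset.Icc 0 ⌊x⌋₊, c n with hD
  have hD' : ∀ t, y ≤ t → |D t| ≤ C * (t * Real.log t ^ (m + 1)) := by
    intro t ht
    have : D t = ∑ n ∈ Finset.Ioc 0 ⌊t⌋₊, c n := by
      rw [hD]
      simp only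
      rw [← Finset.add_sum_Ioc_eq_sum_Icc (Nat.zero_le _)]
      simp [hc, hM]
    rw [this]
    exact hX t (by linarith)
  set g : ℝ → ℝ := fun t => (t * Real.log t ^ (M + 1))⁻¹ with hg
  have hgd : ∀ t ∈ Set.Icc y z, HasDerivAt g
      (-((Real.log t + (M + 1)) / (t ^ 2 * Real.log t ^ (M + 2)))) t := fun t ht =>
    hasDerivAt_inv_mul_log_pow M (by linarith [ht.1])
  have hcont : ContinuousOn
      (fun t : ℝ => -((Real.log t + (M + 1)) / (t ^ 2 * Real.log t ^ (M + 2)))) (Set.Icc y z) := by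
    have hl : ContinuousOn Real.log (Set.Icc y z) :=
      Real.continuousOn_log.mono fun t ht => by
        have : 0 < t := by linarith [ht.1]
        simpa using this.ne'
    refine (ContinuousOn.div (by fun_prop) (by fun_prop) fun t ht => ?_).neg
    have := hlog t ht.1
    have : 0 < t := by linarith [ht.1]
    positivity
  have habel := sum_mul_eq_sub_sub_integral_mul c (f := g) (by linarith) hyz
    (fun t ht => (hgd t ht).differentiableAt)
    (hcont.integrableOn_Icc.congr_fun (fun t ht => (hgd t ht).deriv.symm) measurableSet_Icc)
  have hsum : ∑ n ∈ Finset.Ioc ⌊y⌋₊ ⌊z⌋₊, (primeLog n - 1) / (n * Real.log n) =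
      ∑ k ∈ Finset.Ioc ⌊y⌋₊ ⌊z⌋₊, g k * c k := by
    refine Finset.sum_congr rfl fun n hn => ?_
    rw [Finset.mem_Ioc, Nat.floor_lt (by linarith)] at hn
    have hl := hlog n hn.1.le
    have hn0 : (0 : ℝ) < n := by linarith
    simp only [hg, hc]
    field_simp
    ring
  have hgD : ∀ t, y ≤ t → |g t * D t| ≤ C * (Real.log y ^ (m + 1))⁻¹ := by
    intro t ht
    have hl := hlog t ht
    have hly := hlog y le_rfl
    have ht0 : 0 < t := by linarith
    have hle : Real.log y ≤ Real.log t := Real.log_le_log (by linarith) ht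
    rw [abs_mul, abs_of_nonneg (by positivity : 0 ≤ g t)]
    calc g t * |D t| ≤ g t * (C * (t * Real.log t ^ (m + 1))) := by
          gcongr
          exact hD' t ht
      _ = C * (Real.log t ^ (m + 2))⁻¹ := by
          simp only [hg, hM]
          field_simp
          ring
      _ ≤ C * (Real.log y ^ (m + 1))⁻¹ := by
          gcongr
          calc Real.log y ^ (m + 1) ≤ Real.log t ^ (m + 1) := by gcongr
            _ ≤ Real.log t ^ (m + 2) := by gcongr; omega
  have hpc : ContinuousOn (fun t : ℝ => (m + 1 : ℝ) / (t * Real.log t ^ (m + 2)))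
      (Set.Icc y z) := by
    have hl : ContinuousOn Real.log (Set.Icc y z) :=
      Real.continuousOn_log.mono fun t ht => by
        have : 0 < t := by linarith [ht.1]
        simpa using this.ne'
    refine ContinuousOn.div (by fun_prop) (by fun_prop) fun t ht => ?_
    have := hlog t ht.1
    have : 0 < t := by linarith [ht.1]
    positivity
  have hFTC : ∫ t in Set.Ioc y z, (m + 1 : ℝ) / (t * Real.log t ^ (m + 2)) =
      (Real.log y ^ (m + 1))⁻¹ - (Real.log z ^ (m + 1))⁻¹ := by
    rw [← intervalIntegral.integral_of_le hyz, intervalIntegral.integral_eq_sub_of_hasDerivAt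
      (f := fun t : ℝ => -(Real.log t ^ (m + 1))⁻¹)]
    · ring
    · intro t ht
      rw [Set.uIcc_of_le hyz] at ht
      exact hasDerivAt_neg_inv_log_pow m (by linarith [ht.1])
    · exact (hpc.intervalIntegrable_of_Icc hyz)
  have hint : |∫ t in Set.Ioc y z, deriv g t * D t| ≤ C * (M + 2) * (Real.log y ^ (m + 1))⁻¹ := by
    have h1 : ‖∫ t in Set.Ioc y z, deriv g t * D t‖ ≤
        ∫ t in Set.Ioc y z, C * (M + 2) * ((m + 1 : ℝ) / (t * Real.log t ^ (m + 2))) := by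
      refine MeasureTheory.norm_integral_le_of_norm_le ?_ ?_
      · exact ((hpc.integrableOn_Icc).mono_set Set.Ioc_subset_Icc_self).const_mul _
      · refine (MeasureTheory.ae_restrict_iff' measurableSet_Ioc).mpr
          (Eventually.of_forall fun t ht => ?_)
        have ht' : t ∈ Set.Icc y z := Set.Ioc_subset_Icc_self ht
        have hl := hlog t ht'.1
        have ht0 : 0 < t := by linarith [ht'.1]
        have hl0 : 0 < Real.log t := by linarith
        rw [(hgd t ht').deriv, norm_mul, norm_neg, Real.norm_of_nonneg (by positivity),
          Real.norm_eq_abs]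
        calc (Real.log t + (M + 1)) / (t ^ 2 * Real.log t ^ (M + 2)) * |D t|
            ≤ ((M + 2) * Real.log t) / (t ^ 2 * Real.log t ^ (M + 2)) *
              (C * (t * Real.log t ^ (m + 1))) := by
              gcongr
              · have : (0 : ℝ) ≤ M := by positivity
                nlinarith
              · exact hD' t ht'.1
          _ = C * (M + 2) * (1 / (t * Real.log t ^ (m + 2))) := by
              simp only [hM]
              field_simp
              ring
          _ ≤ _ := by
              gcongr
              linarith [(Nat.cast_nonneg m : (0 : ℝ) ≤ m)]
    rw [MeasureTheory.integral_const_mul, hFTC] at h1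
    refine h1.trans ?_
    have := hlog z hyz
    gcongr
    have : 0 ≤ (Real.log z ^ (m + 1))⁻¹ := by positivity
    linarith
  rw [hsum, habel]
  have a1 := hgD y le_rfl
  have a2 := hgD z hyz
  calc |g z * D z - g y * D y - ∫ t in Set.Ioc y z, deriv g t * D t|
      ≤ |g z * D z| + |g y * D y| + |∫ t in Set.Ioc y z, deriv g t * D t| :=
        (abs_sub _ _).trans (by gcongr; exact abs_sub _ _)
    _ ≤ _ := by linarith

lemma log_log_succ_sub_le {n : ℕ} (hn : 2 ≤ n) :
    Real.log (Real.log (n + 1)) - Real.log (Real.log n) ≤ 1 / (n * Real.log n) := by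
  have hn1 : (1 : ℝ) < n := by exact_mod_cast hn
  have hl : 0 < Real.log n := Real.log_pos hn1
  have hl' : 0 < Real.log (n + 1) := Real.log_pos (by linarith)
  have h1 : Real.log (n + 1) - Real.log n ≤ 1 / n := by
    rw [← Real.log_div (by positivity) (by positivity)]
    refine (Real.log_le_sub_one_of_pos (by positivity)).trans (le_of_eq ?_)
    field_simp
    ring
  rw [← Real.log_div hl'.ne' hl.ne']
  refine (Real.log_le_sub_one_of_pos (by positivity)).trans ?_
  calc Real.log (n + 1) / Real.log n - 1 = (Real.log (n + 1) - Real.log n) / Real.log n := by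
        field_simp
    _ ≤ 1 / n / Real.log n := by gcongr
    _ = _ := by rw [div_div]

lemma le_log_log_succ_sub {n : ℕ} (hn : 2 ≤ n) :
    1 / (((n + 1 : ℕ) : ℝ) * Real.log (n + 1 : ℕ)) ≤
      Real.log (Real.log (n + 1)) - Real.log (Real.log n) := by
  have hn1 : (1 : ℝ) < n := by exact_mod_cast hn
  have hl : 0 < Real.log n := Real.log_pos hn1
  have hl' : 0 < Real.log (n + 1) := Real.log_pos (by linarith)
  have h1 : 1 / (n + 1 : ℝ) ≤ Real.log (n + 1) - Real.log n := by
    rw [← Real.log_div (by positivity) (by positivity)]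
    refine le_trans (le_of_eq ?_) (Real.one_sub_inv_le_log_of_pos (by positivity))
    field_simp
    ring
  push_cast
  rw [← Real.log_div hl'.ne' hl.ne']
  refine le_trans ?_ (Real.one_sub_inv_le_log_of_pos (by positivity))
  calc 1 / ((n + 1 : ℝ) * Real.log (n + 1)) = 1 / (n + 1 : ℝ) / Real.log (n + 1) := by
        rw [div_div]
    _ ≤ (Real.log (n + 1) - Real.log n) / Real.log (n + 1) := by gcongr
    _ = _ := by field_simp

lemma sum_Ioc_one_div_mul_log_bounds {a b : ℕ} (ha : 2 ≤ a) (hab : a ≤ b) :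
    Real.log (Real.log (b + 1)) - Real.log (Real.log (a + 1)) ≤
      ∑ n ∈ Finset.Ioc a b, 1 / ((n : ℝ) * Real.log n) ∧
    ∑ n ∈ Finset.Ioc a b, 1 / ((n : ℝ) * Real.log n) ≤
      Real.log (Real.log b) - Real.log (Real.log a) := by
  induction b, hab using Nat.le_induction with
  | base => simp
  | succ b hab ih =>
    rw [Finset.sum_Ioc_succ_top hab]
    have h1 := le_log_log_succ_sub (ha.trans hab)
    have h2 := log_log_succ_sub_le (n := b + 1) (by omega)
    push_cast at h1 h2 ⊢
    constructor <;> linarith [ih.1, ih.2]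

lemma log_log_mono {x y : ℝ} (hx : 1 < x) (hxy : x ≤ y) :
    Real.log (Real.log x) ≤ Real.log (Real.log y) :=
  Real.log_le_log (Real.log_pos hx) (Real.log_le_log (by linarith) hxy)

lemma abs_sum_one_div_mul_log_sub_le {y z : ℝ} (hy : 3 ≤ y) (hyz : y ≤ z) :
    |∑ n ∈ Finset.Ioc ⌊y⌋₊ ⌊z⌋₊, 1 / ((n : ℝ) * Real.log n) -
      (Real.log (Real.log z) - Real.log (Real.log y))| ≤ 2 / y := by
  have ha : 3 ≤ ⌊y⌋₊ := Nat.le_floor (by exact_mod_cast hy)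
  have hab := Nat.floor_mono hyz
  obtain ⟨h1, h2⟩ := sum_Ioc_one_div_mul_log_bounds (by omega) hab
  have h3 := log_log_succ_sub_le (n := ⌊y⌋₊) (by omega)
  have ha' : (3 : ℝ) ≤ ⌊y⌋₊ := by exact_mod_cast ha
  have hab' : (⌊y⌋₊ : ℝ) ≤ ⌊z⌋₊ := by exact_mod_cast hab
  have y1 := Nat.floor_le (show 0 ≤ y by linarith)
  have y2 := Nat.lt_floor_add_one y
  have z1 := Nat.floor_le (show 0 ≤ z by linarith)
  have z2 := Nat.lt_floor_add_one z
  have m1 := log_log_mono (by linarith) y1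
  have m2 := log_log_mono (by linarith) y2.le
  have m3 := log_log_mono (by linarith) z1
  have m4 := log_log_mono (by linarith) z2.le
  have h4 : 1 / ((⌊y⌋₊ : ℝ) * Real.log ⌊y⌋₊) ≤ 2 / y := by
    have : 1 ≤ Real.log ⌊y⌋₊ := by
      rw [Real.le_log_iff_exp_le (by linarith)]
      linarith [Real.exp_one_lt_d9]
    calc 1 / ((⌊y⌋₊ : ℝ) * Real.log ⌊y⌋₊) ≤ 1 / ((y / 2) * 1) := by gcongr; linarith
      _ = 2 / y := by field_simp
  rw [abs_le]
  constructor <;> linarith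

/-- `1 / p` at primes `p` and zero elsewhere. -/
noncomputable def primeInv (n : ℕ) : ℝ := if n.Prime then (n : ℝ)⁻¹ else 0

/-- `∑_{p ≤ x} 1 / p - log log x`. -/
noncomputable def mertensDiff (x : ℝ) : ℝ :=
  ∑ n ∈ Finset.Ioc 0 ⌊x⌋₊, primeInv n - Real.log (Real.log x)

lemma exists_abs_mertensDiff_sub_le (m : ℕ) : ∃ K : ℝ, 0 < K ∧ ∀ᶠ y : ℝ in atTop, ∀ z, y ≤ z →
    |mertensDiff z - mertensDiff y| ≤ K * (Real.log y ^ (m + 1))⁻¹ := by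
  obtain ⟨K, hK, h⟩ := exists_abs_sum_primeLog_div_le m
  refine ⟨K + 2, by positivity, ?_⟩
  have hlo : ∀ᶠ x : ℝ in atTop, Real.log x ^ (m + 1) ≤ x := by
    have := (Real.isLittleO_pow_log_id_atTop (n := m + 1)).bound (show (0 : ℝ) < 1 by norm_num)
    filter_upwards [this, eventually_ge_atTop 1] with x hx hx1
    rw [id, Real.norm_of_nonneg (by linarith : (0 : ℝ) ≤ x)] at hx
    linarith [(le_abs_self _).trans hx]
  filter_upwards [h, hlo, eventually_ge_atTop 3] with y h1 h2 hy z hyz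
  have hl : 0 < Real.log y := Real.log_pos (by linarith)
  have h3 := h1 z hyz
  have h4 := abs_sum_one_div_mul_log_sub_le hy hyz
  have h5 : 2 / y ≤ 2 * (Real.log y ^ (m + 1))⁻¹ := by
    rw [div_eq_mul_inv]; gcongr
  have hsplit := Finset.sum_Ioc_consecutive primeInv (Nat.zero_le _) (Nat.floor_mono hyz)
  have h6 : ∑ n ∈ Finset.Ioc ⌊y⌋₊ ⌊z⌋₊, (primeLog n - 1) / (n * Real.log n) =
      ∑ n ∈ Finset.Ioc ⌊y⌋₊ ⌊z⌋₊, primeInv n -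
        ∑ n ∈ Finset.Ioc ⌊y⌋₊ ⌊z⌋₊, 1 / ((n : ℝ) * Real.log n) := by
    rw [← Finset.sum_sub_distrib]
    refine Finset.sum_congr rfl fun n hn => ?_
    rw [Finset.mem_Ioc, Nat.floor_lt (by linarith)] at hn
    have hln : 0 < Real.log n := Real.log_pos (by linarith)
    have hn0 : (0 : ℝ) < n := by linarith
    unfold primeLog primeInv
    split_ifs
    · field_simp
    · ring
  rw [h6] at h3
  have h7 : mertensDiff z - mertensDiff y =
      (∑ n ∈ Finset.Ioc ⌊y⌋₊ ⌊z⌋₊, primeInv n -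
        ∑ n ∈ Finset.Ioc ⌊y⌋₊ ⌊z⌋₊, 1 / ((n : ℝ) * Real.log n)) +
      (∑ n ∈ Finset.Ioc ⌊y⌋₊ ⌊z⌋₊, 1 / ((n : ℝ) * Real.log n) -
      (Real.log (Real.log z) - Real.log (Real.log y))) := by
    unfold mertensDiff
    rw [← hsplit]
    ring
  rw [h7]
  refine (abs_add_le _ _).trans ?_
  linarith

lemma tendsto_inv_log_pow_succ (m : ℕ) :
    Tendsto (fun x : ℝ => (Real.log x ^ (m + 1))⁻¹) atTop (nhds 0) :=
  ((tendsto_pow_atTop (by omega)).comp Real.tendsto_log_atTop).inv_tendsto_atTop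

/-- The Mertens theorem with an error term smaller than any power of the logarithm. -/
lemma exists_mertensDiff_sub_isBigO : ∃ M : ℝ, ∀ m : ℕ,
    (fun x => mertensDiff x - M) =O[atTop] fun x => (Real.log x ^ (m + 1))⁻¹ := by
  have hcauchy : ∃ M, Tendsto mertensDiff atTop (nhds M) := by
    refine cauchySeq_tendsto_of_complete (Metric.cauchySeq_iff'.mpr fun ε hε => ?_)
    obtain ⟨K, hK, h⟩ := exists_abs_mertensDiff_sub_le 0
    have h0 := (tendsto_inv_log_pow_succ 0).const_mul K
    rw [mul_zero] at h0
    obtain ⟨y, h1, h2⟩ := (h.and (h0.eventually_lt_const hε)).exists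
    exact ⟨y, fun z hz => (h1 z hz).trans_lt h2⟩
  obtain ⟨M, hM⟩ := hcauchy
  refine ⟨M, fun m => ?_⟩
  obtain ⟨K, hK, h⟩ := exists_abs_mertensDiff_sub_le m
  refine Asymptotics.IsBigO.of_bound K ?_
  filter_upwards [h, eventually_ge_atTop 1] with y hy hy1
  have hl := Real.log_nonneg hy1
  rw [Real.norm_eq_abs, Real.norm_of_nonneg (by positivity), abs_sub_comm]
  refine le_of_tendsto (hM.sub_const (mertensDiff y)).abs ?_
  filter_upwards [eventually_ge_atTop y] with z hz using hy z hz

lemma integrableOn_log_mul_exp_neg_and_integral :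
    MeasureTheory.IntegrableOn (fun v : ℝ => Real.log v * Real.exp (-v)) (Set.Ioi 0) ∧
      ∫ v in Set.Ioi (0 : ℝ), Real.log v * Real.exp (-v) = -Real.eulerMascheroniConstant := by
  have hs : (0 : ℝ) < (1 : ℂ).re := by simp
  have key : MellinConvergent (fun t : ℝ => Real.log t • (↑(Real.exp (-t)) : ℂ)) 1 := by
    refine (mellin_hasDerivAt_of_isBigO_rpow (E := ℂ) ?_ ?_ (lt_add_one _) ?_ hs).1
    · refine (Continuous.continuousOn ?_).locallyIntegrableOn measurableSet_Ioi
      exact Complex.continuous_ofReal.comp (Real.continuous_exp.comp continuous_neg)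
    · rw [← Asymptotics.isBigO_norm_left]
      simp_rw [Complex.norm_real, Asymptotics.isBigO_norm_left]
      simpa only [neg_one_mul] using (isLittleO_exp_neg_mul_rpow_atTop zero_lt_one _).isBigO
    · simp_rw [neg_zero, Real.rpow_zero]
      refine Asymptotics.isBigO_const_of_tendsto (?_ : Tendsto _ _ (nhds (1 : ℂ))) one_ne_zero
      rw [(by simp : (1 : ℂ) = Real.exp (-0))]
      exact (Complex.continuous_ofReal.comp
        (Real.continuous_exp.comp continuous_neg)).continuousWithinAt
  have hfun : (fun t : ℝ => (t : ℂ) ^ ((1 : ℂ) - 1) * (Real.log t * Real.exp (-t))) =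
      fun t : ℝ => ((Real.log t * Real.exp (-t) : ℝ) : ℂ) := by
    funext t
    simp
  constructor
  · unfold MellinConvergent at key
    have h2 := key.re
    refine h2.congr (MeasureTheory.ae_of_all _ fun t => ?_)
    beta_reduce
    rw [sub_self, Complex.cpow_zero, smul_eq_mul, one_mul, RCLike.re_eq_complex_re,
      Complex.smul_re, Complex.ofReal_re, smul_eq_mul]
  · have h1 := Complex.hasDerivAt_GammaIntegral hs
    rw [hfun, integral_complex_ofReal] at h1
    have h2 : HasDerivAt Complex.GammaIntegral
        (-Real.eulerMascheroniConstant : ℂ) 1 := by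
      refine Complex.hasDerivAt_Gamma_one.congr_of_eventuallyEq ?_
      have : IsOpen {s : ℂ | 0 < s.re} := Complex.continuous_re.isOpen_preimage _ isOpen_Ioi
      filter_upwards [this.mem_nhds hs] with a ha using (Complex.Gamma_eq_integral ha).symm
    exact_mod_cast h1.unique h2

/-- The logarithm of an Euler factor, minus its first order term, at the power `w` of the index. -/
noncomputable def eulerRest (w : ℝ) (n : ℕ) : ℝ :=
  if n.Prime then -Real.log (1 - (n : ℝ) ^ (-w)) - (n : ℝ) ^ (-w) else 0

lemma abs_neg_log_one_sub_sub_le {x : ℝ} (hx : |x| ≤ 1 / 2) :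
    |-Real.log (1 - x) - x| ≤ 2 * x ^ 2 := by
  have h := Real.abs_log_sub_add_sum_range_le (lt_of_le_of_lt hx (by norm_num)) 1
  simp only [Finset.sum_range_one, zero_add, pow_one, Nat.cast_zero, div_one] at h
  rw [show -Real.log (1 - x) - x = -(x + Real.log (1 - x)) by ring, abs_neg]
  refine h.trans ?_
  rw [one_add_one_eq_two, sq_abs, div_le_iff₀ (by linarith)]
  nlinarith [sq_nonneg x]

lemma natCast_rpow_neg_le_inv {w : ℝ} (hw : 1 ≤ w) {n : ℕ} (hn : 1 ≤ n) :
    (n : ℝ) ^ (-w) ≤ (n : ℝ)⁻¹ := by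
  rw [← Real.rpow_neg_one]
  exact Real.rpow_le_rpow_of_exponent_le (by exact_mod_cast hn) (by linarith)

lemma abs_eulerRest_le {w : ℝ} (hw : 1 ≤ w) (n : ℕ) : |eulerRest w n| ≤ 2 * (1 / (n : ℝ) ^ 2) := by
  unfold eulerRest
  split_ifs with hp
  · have h1 := natCast_rpow_neg_le_inv hw hp.one_le
    have h2 : (n : ℝ)⁻¹ ≤ 1 / 2 := by
      rw [one_div]
      exact inv_anti₀ (by norm_num) (by exact_mod_cast hp.two_le)
    have h0 : 0 ≤ (n : ℝ) ^ (-w) := by positivity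
    refine (abs_neg_log_one_sub_sub_le (by rw [abs_of_nonneg h0]; linarith)).trans ?_
    rw [one_div, ← inv_pow]
    gcongr
  · simp

lemma summable_two_mul_one_div_sq : Summable fun n : ℕ => 2 * (1 / (n : ℝ) ^ 2) :=
  (Real.summable_one_div_nat_pow.mpr one_lt_two).mul_left 2

lemma tendsto_tsum_eulerRest :
    Tendsto (fun w => ∑' n, eulerRest w n) (nhdsWithin 1 (Set.Ioi 1))
      (nhds (∑' n, eulerRest 1 n)) := by
  refine tendsto_tsum_of_dominated_convergence summable_two_mul_one_div_sq (fun n => ?_) ?_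
  · refine Tendsto.mono_left ?_ nhdsWithin_le_nhds
    unfold eulerRest
    split_ifs with hp
    · have hn : (n : ℝ) ≠ 0 := by exact_mod_cast hp.ne_zero
      have h1 : ContinuousAt (fun w : ℝ => (n : ℝ) ^ (-w)) 1 :=
        ContinuousAt.rpow continuousAt_const continuous_neg.continuousAt (Or.inl hn)
      refine ((ContinuousAt.log (continuousAt_const.sub h1) ?_).neg.sub h1)
      have : (n : ℝ) ^ (-1 : ℝ) < 1 := by
        rw [Real.rpow_neg_one]
        exact inv_lt_one_of_one_lt₀ (by exact_mod_cast hp.one_lt)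
      exact (sub_pos.mpr this).ne'
    · exact tendsto_const_nhds
  · filter_upwards [self_mem_nhdsWithin] with w hw n
    exact abs_eulerRest_le (le_of_lt hw) n

lemma summable_primeInv_mul_rpow {δ : ℝ} (hδ : 0 < δ) :
    Summable fun n : ℕ => primeInv n * (n : ℝ) ^ (-δ) := by
  refine Summable.of_nonneg_of_le (fun n => ?_) (fun n => ?_)
    (Real.summable_nat_rpow.mpr (show -(1 + δ) < -1 by linarith))
  · unfold primeInv; split_ifs <;> positivity
  · unfold primeInv
    split_ifs with hp
    · have hn : (0 : ℝ) < n := by exact_mod_cast hp.pos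
      rw [neg_add, Real.rpow_add hn, Real.rpow_neg_one]
    · rw [zero_mul]; positivity

lemma log_riemannZeta_eq_tsum {δ : ℝ} (hδ : 0 < δ) :
    Real.log (riemannZeta ((1 + δ : ℝ) : ℂ)).re =
      ∑' n : ℕ, primeInv n * (n : ℝ) ^ (-δ) + ∑' n, eulerRest (1 + δ) n := by
  have hs : 1 < ((1 + δ : ℝ) : ℂ).re := by simpa using hδ
  have hsum : Summable (eulerRest (1 + δ)) :=
    Summable.of_norm_bounded summable_two_mul_one_div_sq
      fun n => abs_eulerRest_le (by linarith) n
  have h1 := riemannZeta_eulerProduct_exp_log hs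
  have h2 : ∀ p : Nat.Primes, -Complex.log (1 - (p : ℂ) ^ (-((1 + δ : ℝ) : ℂ))) =
      ((-Real.log (1 - ((p : ℕ) : ℝ) ^ (-(1 + δ))) : ℝ) : ℂ) := fun p => by
    have h3 := natCast_rpow_neg_le_inv (w := 1 + δ) (by linarith) p.2.one_le
    have h4 : ((p : ℕ) : ℝ)⁻¹ < 1 := inv_lt_one_of_one_lt₀ (by exact_mod_cast p.2.one_lt)
    rw [Complex.ofReal_neg, Complex.ofReal_log (by linarith), Complex.ofReal_sub,
      Complex.ofReal_cpow (by positivity)]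
    simp
  rw [tsum_congr h2, ← Complex.ofReal_tsum, ← Complex.ofReal_exp] at h1
  rw [← h1, Complex.ofReal_re, Real.log_exp, ← (summable_primeInv_mul_rpow hδ).tsum_add hsum]
  have h5 := tsum_subtype {p : ℕ | p.Prime} fun n : ℕ => -Real.log (1 - (n : ℝ) ^ (-(1 + δ)))
  refine Eq.trans h5 (tsum_congr fun n => ?_)
  unfold eulerRest primeInv Set.indicator
  simp only [Set.mem_ofPred_eq]
  split_ifs with hp
  · have hn : (0 : ℝ) < n := by exact_mod_cast hp.pos
    rw [neg_add, Real.rpow_add hn, Real.rpow_neg_one]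
    ring
  · ring

lemma tendsto_tsum_primeInv_add_log :
    Tendsto (fun δ : ℝ => ∑' n : ℕ, primeInv n * (n : ℝ) ^ (-δ) + Real.log δ)
      (nhdsWithin 0 (Set.Ioi 0)) (nhds (-∑' n, eulerRest 1 n)) := by
  have hmap : Tendsto (fun δ : ℝ => 1 + δ) (nhdsWithin 0 (Set.Ioi 0))
      (nhdsWithin 1 (Set.Ioi 1)) := by
    refine tendsto_nhdsWithin_iff.mpr ⟨?_, ?_⟩
    · refine Tendsto.mono_left ?_ nhdsWithin_le_nhds
      have : Continuous fun δ : ℝ => 1 + δ := by fun_prop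
      simpa using this.tendsto 0
    · filter_upwards [self_mem_nhdsWithin] with δ hδ
      simpa using hδ
  have h1 := ((Asymptotics.isLittleO_one_iff ℝ).mp
    log_riemannZeta_add_log_sub_isLittleO_ofReal).comp hmap
  have h2 := h1.sub (tendsto_tsum_eulerRest.comp hmap)
  rw [zero_sub] at h2
  refine h2.congr' ?_
  filter_upwards [self_mem_nhdsWithin] with δ hδ
  simp only [Function.comp_apply]
  rw [log_riemannZeta_eq_tsum hδ, add_sub_cancel_left]
  ring

lemma primeInv_nonneg (n : ℕ) : 0 ≤ primeInv n := by
  unfold primeInv; split_ifs <;> positivity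

lemma integral_sum_primeInv_mul_exp_neg {δ : ℝ} (hδ : 0 < δ) :
    ∫ v in Set.Ioi (0 : ℝ), (∑ n ∈ Finset.Ioc 0 ⌊Real.exp (v / δ)⌋₊, primeInv n) * Real.exp (-v) =
      ∑' n : ℕ, primeInv n * (n : ℝ) ^ (-δ) := by
  set F : ℕ → ℝ → ℝ := fun n =>
    (Set.Ici (δ * Real.log n)).indicator fun v => primeInv n * Real.exp (-v) with hF
  have hmul : ∀ n : ℕ, 0 ≤ δ * Real.log n := fun n => mul_nonneg hδ.le (Real.log_natCast_nonneg n)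
  have hint : ∀ n : ℕ, ∫ v in Set.Ioi (0 : ℝ), F n v = primeInv n * (n : ℝ) ^ (-δ) := fun n => by
    rw [MeasureTheory.setIntegral_indicator measurableSet_Ici, MeasureTheory.integral_const_mul]
    by_cases hp : n.Prime
    · have hn : (0 : ℝ) < n := by exact_mod_cast hp.pos
      have hn1 : (1 : ℝ) < n := by exact_mod_cast hp.one_lt
      have : Set.Ioi (0 : ℝ) ∩ Set.Ici (δ * Real.log n) = Set.Ici (δ * Real.log n) :=
        Set.inter_eq_right.mpr fun v hv =>
          lt_of_lt_of_le (mul_pos hδ (Real.log_pos hn1)) hv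
      rw [this, MeasureTheory.integral_Ici_eq_integral_Ioi, integral_exp_neg_Ioi,
        Real.rpow_def_of_pos hn]
      ring_nf
    · simp [primeInv, hp]
  have hFint : ∀ n, MeasureTheory.Integrable (F n)
      (MeasureTheory.volume.restrict (Set.Ioi (0 : ℝ))) := fun n =>
    ((integrableOn_exp_neg_Ioi 0).const_mul (primeInv n)).indicator measurableSet_Ici
  have hnn : ∀ n v, 0 ≤ F n v := fun n v =>
    Set.indicator_nonneg (fun v _ => mul_nonneg (primeInv_nonneg n) (Real.exp_nonneg _)) v
  have hs : Summable fun n => ∫ v in Set.Ioi (0 : ℝ), ‖F n v‖ := by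
    simp_rw [Real.norm_of_nonneg (hnn _ _), hint]
    exact summable_primeInv_mul_rpow hδ
  have h := (MeasureTheory.hasSum_integral_of_summable_integral_norm hFint hs).tsum_eq
  rw [tsum_congr hint] at h
  rw [h]
  refine MeasureTheory.setIntegral_congr_fun measurableSet_Ioi fun v hv => ?_
  have hmem : ∀ n : ℕ, n ∈ Finset.Ioc 0 ⌊Real.exp (v / δ)⌋₊ ↔ 0 < n ∧ δ * Real.log n ≤ v := by
    intro n
    rw [Finset.mem_Ioc]
    refine and_congr_right fun hn => ?_
    rw [Nat.le_floor_iff (Real.exp_nonneg _), ← Real.log_le_iff_le_exp (by exact_mod_cast hn),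
      le_div_iff₀ hδ, mul_comm]
  rw [tsum_eq_sum (s := Finset.Ioc 0 ⌊Real.exp (v / δ)⌋₊), Finset.sum_mul]
  · refine Finset.sum_congr rfl fun n hn => ?_
    exact (Set.indicator_of_mem (s := Set.Ici (δ * Real.log n)) ((hmem n).mp hn).2
      fun v => primeInv n * Real.exp (-v)).symm
  · intro n hn
    rw [hmem] at hn
    by_cases hp : n.Prime
    · exact Set.indicator_of_notMem (fun hh => hn ⟨hp.pos, hh⟩) _
    · simp [hF, primeInv, hp, Set.indicator]

lemma exists_abs_mertensDiff_exp_sub_le {M : ℝ} (hM : Tendsto mertensDiff atTop (nhds M)) :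
    ∃ C : ℝ, ∀ v > 0, ∀ w ≥ v, |mertensDiff (Real.exp w) - M| ≤ C + |Real.log v| := by
  have h1 : ∀ᶠ w in atTop, |mertensDiff (Real.exp w) - M| ≤ 1 := by
    have := ((hM.comp Real.tendsto_exp_atTop).sub_const M).abs
    rw [sub_self, abs_zero] at this
    exact (this.eventually_lt_const one_pos).mono fun w hw => le_of_lt hw
  obtain ⟨W, hW⟩ := eventually_atTop.mp h1
  set W0 := max 1 W with hW0
  have hW1 : 1 ≤ W0 := le_max_left _ _
  set S := ∑ n ∈ Finset.Ioc 0 ⌊Real.exp W0⌋₊, primeInv n with hS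
  have hS0 : 0 ≤ S := Finset.sum_nonneg fun n _ => primeInv_nonneg n
  have hl0 := Real.log_nonneg hW1
  refine ⟨1 + S + Real.log W0 + |M|, fun v hv w hw => ?_⟩
  have hv0 := abs_nonneg (Real.log v)
  have hM0 := abs_nonneg M
  rcases le_or_gt W w with h | h
  · linarith [hW w h]
  · have hwW : w ≤ W0 := h.le.trans (le_max_right _ _)
    have hw0 : 0 < w := lt_of_lt_of_le hv hw
    have h2 : ∑ n ∈ Finset.Ioc 0 ⌊Real.exp w⌋₊, primeInv n ≤ S := by
      refine Finset.sum_le_sum_of_subset_of_nonneg ?_ fun n _ _ => primeInv_nonneg n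
      exact Finset.Ioc_subset_Ioc_right (Nat.floor_mono (Real.exp_le_exp.mpr hwW))
    have h3 : 0 ≤ ∑ n ∈ Finset.Ioc 0 ⌊Real.exp w⌋₊, primeInv n :=
      Finset.sum_nonneg fun n _ => primeInv_nonneg n
    have h4 := Real.log_le_log hw0 hwW
    have h5 := Real.log_le_log hv hw
    have h6 := neg_abs_le (Real.log v)
    have h7 := neg_abs_le M
    have h8 := le_abs_self M
    unfold mertensDiff
    rw [Real.log_exp, abs_le]
    constructor <;> linarith

lemma measurable_mertensDiff : Measurable mertensDiff := by
  unfold mertensDiff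
  refine Measurable.sub ?_ (Real.measurable_log.comp Real.measurable_log)
  exact (measurable_from_nat (f := fun k => ∑ n ∈ Finset.Ioc 0 k, primeInv n)).comp
    Nat.measurable_floor

lemma integrableOn_abs_log_mul_exp_neg (C : ℝ) : MeasureTheory.IntegrableOn
    (fun v : ℝ => (C + |Real.log v|) * Real.exp (-v)) (Set.Ioi 0) := by
  have h := integrableOn_log_mul_exp_neg_and_integral.1.abs
  refine (((integrableOn_exp_neg_Ioi 0).const_mul C).add h).congr
    (MeasureTheory.ae_of_all _ fun v => ?_)
  simp only [Pi.add_apply, abs_mul, abs_of_nonneg (Real.exp_nonneg (-v))]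
  ring

lemma norm_mertensDiff_exp_mul_le {M C δ v : ℝ}
    (hC : ∀ v > 0, ∀ w ≥ v, |mertensDiff (Real.exp w) - M| ≤ C + |Real.log v|)
    (hδ : 0 < δ) (hδ1 : δ ≤ 1) (hv : 0 < v) :
    ‖(mertensDiff (Real.exp (v / δ)) - M) * Real.exp (-v)‖ ≤
      (C + |Real.log v|) * Real.exp (-v) := by
  rw [norm_mul, Real.norm_of_nonneg (Real.exp_nonneg _), Real.norm_eq_abs]
  refine mul_le_mul_of_nonneg_right (hC v hv _ ?_) (Real.exp_nonneg _)
  exact (le_div_iff₀ hδ).mpr (by nlinarith)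

lemma aestronglyMeasurable_mertensDiff_exp_mul (M δ : ℝ) (μ : MeasureTheory.Measure ℝ) :
    MeasureTheory.AEStronglyMeasurable
      (fun v => (mertensDiff (Real.exp (v / δ)) - M) * Real.exp (-v)) μ := by
  refine Measurable.aestronglyMeasurable ?_
  have h : Measurable fun v : ℝ => mertensDiff (Real.exp (v / δ)) :=
    measurable_mertensDiff.comp (by fun_prop)
  exact (h.sub_const M).mul (by fun_prop)

lemma tendsto_integral_mertensDiff {M : ℝ} (hM : Tendsto mertensDiff atTop (nhds M)) :
    Tendsto (fun δ : ℝ => ∫ v in Set.Ioi (0 : ℝ),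
        (mertensDiff (Real.exp (v / δ)) - M) * Real.exp (-v))
      (nhdsWithin 0 (Set.Ioi 0)) (nhds 0) := by
  obtain ⟨C, hC⟩ := exists_abs_mertensDiff_exp_sub_le hM
  rw [show (0 : ℝ) = ∫ v in Set.Ioi (0 : ℝ), (0 : ℝ) by simp]
  have hsmall : ∀ᶠ δ : ℝ in nhdsWithin 0 (Set.Ioi 0), 0 < δ ∧ δ ≤ 1 := by
    filter_upwards [Ioc_mem_nhdsGT (show (0 : ℝ) < 1 by norm_num)] with δ hδ using hδ
  simp only [MeasureTheory.integral_zero]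
  have := MeasureTheory.tendsto_integral_filter_of_dominated_convergence
    (μ := MeasureTheory.volume.restrict (Set.Ioi (0 : ℝ)))
    (l := nhdsWithin (0 : ℝ) (Set.Ioi 0))
    (F := fun δ v => (mertensDiff (Real.exp (v / δ)) - M) * Real.exp (-v)) (f := fun _ => 0)
    (fun v => (C + |Real.log v|) * Real.exp (-v))
    (Eventually.of_forall fun δ => aestronglyMeasurable_mertensDiff_exp_mul M δ _) ?_
    (integrableOn_abs_log_mul_exp_neg C) ?_
  · simpa using this
  · filter_upwards [hsmall] with δ hδ
    exact MeasureTheory.ae_restrict_of_forall_mem measurableSet_Ioi fun v hv =>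
      norm_mertensDiff_exp_mul_le hC hδ.1 hδ.2 hv
  · refine MeasureTheory.ae_restrict_of_forall_mem measurableSet_Ioi fun v hv => ?_
    have h1 : Tendsto (fun δ : ℝ => v / δ) (nhdsWithin 0 (Set.Ioi 0)) atTop := by
      simp_rw [div_eq_mul_inv]
      exact tendsto_inv_nhdsGT_zero.const_mul_atTop hv
    have h2 := (((hM.comp Real.tendsto_exp_atTop).comp h1).sub_const M).mul_const (Real.exp (-v))
    simpa using h2

lemma integral_mertensDiff_eq {M : ℝ} (hM : Tendsto mertensDiff atTop (nhds M)) {δ : ℝ}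
    (hδ : 0 < δ) (hδ1 : δ ≤ 1) :
    ∫ v in Set.Ioi (0 : ℝ), (mertensDiff (Real.exp (v / δ)) - M) * Real.exp (-v) =
      ∑' n : ℕ, primeInv n * (n : ℝ) ^ (-δ) + Real.log δ - M + Real.eulerMascheroniConstant := by
  obtain ⟨C, hC⟩ := exists_abs_mertensDiff_exp_sub_le hM
  obtain ⟨hlog, hlog'⟩ := integrableOn_log_mul_exp_neg_and_integral
  have hexp := integrableOn_exp_neg_Ioi (0 : ℝ)
  have hD : MeasureTheory.IntegrableOn
      (fun v => (mertensDiff (Real.exp (v / δ)) - M) * Real.exp (-v)) (Set.Ioi 0) :=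
    (integrableOn_abs_log_mul_exp_neg C).mono' (aestronglyMeasurable_mertensDiff_exp_mul M δ _)
      (MeasureTheory.ae_restrict_of_forall_mem measurableSet_Ioi fun v hv =>
        norm_mertensDiff_exp_mul_le hC hδ hδ1 hv)
  have hc := hexp.const_mul (M - Real.log δ)
  have hDl : MeasureTheory.IntegrableOn (fun v => (mertensDiff (Real.exp (v / δ)) - M) *
      Real.exp (-v) + Real.log v * Real.exp (-v)) (Set.Ioi 0) := hD.add hlog
  have hpt : Set.EqOn
      (fun v => (∑ n ∈ Finset.Ioc 0 ⌊Real.exp (v / δ)⌋₊, primeInv n) * Real.exp (-v))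
      (fun v => ((mertensDiff (Real.exp (v / δ)) - M) * Real.exp (-v) +
        Real.log v * Real.exp (-v)) + (M - Real.log δ) * Real.exp (-v)) (Set.Ioi 0) :=
    fun v hv => by
      simp only [mertensDiff]
      rw [Real.log_exp, Real.log_div (ne_of_gt hv) hδ.ne']
      ring
  have h1 := integral_sum_primeInv_mul_exp_neg hδ
  rw [MeasureTheory.setIntegral_congr_fun measurableSet_Ioi hpt,
    MeasureTheory.integral_add hDl hc, MeasureTheory.integral_add hD hlog, hlog',
    MeasureTheory.integral_const_mul, integral_exp_neg_Ioi] at h1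
  rw [neg_zero, Real.exp_zero] at h1
  linarith

/-- The Mertens constant is expressed through the Euler–Mascheroni constant. -/
lemma mertens_limit_add_tsum_eulerRest {M : ℝ} (hM : Tendsto mertensDiff atTop (nhds M)) :
    M + ∑' n, eulerRest 1 n = Real.eulerMascheroniConstant := by
  have h1 := tendsto_integral_mertensDiff hM
  have h2 := (tendsto_tsum_primeInv_add_log.sub_const M).add_const Real.eulerMascheroniConstant
  have h3 := h1.congr' (f₂ := fun δ : ℝ => ∑' n : ℕ, primeInv n * (n : ℝ) ^ (-δ) + Real.log δ
      - M + Real.eulerMascheroniConstant) (by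
    filter_upwards [Ioc_mem_nhdsGT (show (0 : ℝ) < 1 by norm_num)] with δ hδ
    exact integral_mertensDiff_eq hM hδ.1 hδ.2)
  linarith [tendsto_nhds_unique h2 h3]

/-- The difference of the normalised logarithmic factor and its first order term. -/
noncomputable def factorRest (s : ℝ) (n : ℕ) : ℝ :=
  if n.Prime then -(1 / s) * Real.log |1 - s / n| - (n : ℝ)⁻¹ else 0

lemma abs_factorRest_le {s : ℝ} (hs0 : s ≠ 0) {n : ℕ} (hn : 2 * |s| ≤ n) :
    |factorRest s n| ≤ 2 * |s| * (1 / (n : ℝ) ^ 2) := by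
  unfold factorRest
  split_ifs with hp
  · have hn0 : (0 : ℝ) < n := by exact_mod_cast hp.pos
    have h1 : |s / n| ≤ 1 / 2 := by
      rw [abs_div, abs_of_pos hn0, div_le_iff₀ hn0]
      linarith
    have h2 := abs_neg_log_one_sub_sub_le h1
    rw [Real.log_abs, show -(1 / s) * Real.log (1 - s / n) - (n : ℝ)⁻¹ =
      s⁻¹ * (-Real.log (1 - s / n) - s / n) by field_simp, abs_mul, abs_inv]
    have h3 : 0 < |s| := abs_pos.mpr hs0
    calc |s|⁻¹ * |-Real.log (1 - s / n) - s / n| ≤ |s|⁻¹ * (2 * (s / n) ^ 2) := by gcongr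
      _ = 2 * |s| * (1 / (n : ℝ) ^ 2) := by
        rw [div_pow, ← sq_abs s]
        field_simp
  · rw [abs_zero]; positivity

lemma summable_factorRest {s : ℝ} (hs0 : s ≠ 0) : Summable (factorRest s) := by
  refine Summable.of_norm_bounded_eventually_nat (g := fun n : ℕ => 2 * |s| * (1 / (n : ℝ) ^ 2))
    ((Real.summable_one_div_nat_pow.mpr one_lt_two).mul_left _) ?_
  filter_upwards [tendsto_natCast_atTop_atTop.eventually_ge_atTop (2 * |s|)] with n hn
  exact abs_factorRest_le hs0 hn

lemma sum_factorRest_sub_tsum_isBigO {s : ℝ} (hs0 : s ≠ 0) :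
    (fun x : ℝ => ∑ n ∈ Finset.range (⌊x⌋₊ + 1), factorRest s n - ∑' n, factorRest s n)
      =O[atTop] fun x : ℝ => x⁻¹ := by
  refine Asymptotics.IsBigO.of_bound (4 * |s|) ?_
  filter_upwards [eventually_ge_atTop 2, eventually_ge_atTop (2 * |s|)] with x hx2 hxs
  have hx0 : 0 < x := by linarith
  set N := ⌊x⌋₊ with hN
  have hN1 : x < N + 1 := Nat.lt_floor_add_one x
  have hN2 : 0 < N := Nat.floor_pos.mpr (by linarith)
  have hN0 : (0 : ℝ) < N := by exact_mod_cast hN2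
  have hlim := (((summable_factorRest hs0).hasSum.tendsto_sum_nat.comp
    (tendsto_add_atTop_nat 1)).sub_const (∑ n ∈ Finset.range (N + 1), factorRest s n)).norm
  rw [norm_sub_rev, Real.norm_of_nonneg (inv_nonneg.mpr hx0.le)]
  refine le_of_tendsto hlim ?_
  filter_upwards [eventually_ge_atTop N] with K hK
  simp only [Function.comp_apply]
  have h1 : ∑ n ∈ Finset.range (K + 1), factorRest s n -
      ∑ n ∈ Finset.range (N + 1), factorRest s n = ∑ n ∈ Finset.Ioc N K, factorRest s n := by
    rw [← Finset.sum_Ico_eq_sub _ (by omega)]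
    refine Finset.sum_congr (Finset.ext fun n => ?_) fun _ _ => rfl
    simp only [Finset.mem_Ico, Finset.mem_Ioc]
    omega
  rw [h1]
  calc ‖∑ n ∈ Finset.Ioc N K, factorRest s n‖
      ≤ ∑ n ∈ Finset.Ioc N K, 2 * |s| * ((n : ℝ) ^ 2)⁻¹ := by
        refine norm_sum_le_of_le _ fun n hn => ?_
        rw [Finset.mem_Ioc] at hn
        have : (N : ℝ) + 1 ≤ n := by exact_mod_cast hn.1
        rw [← one_div]
        exact abs_factorRest_le hs0 (by linarith)
    _ ≤ 2 * |s| * ((N : ℝ)⁻¹ - (K : ℝ)⁻¹) := by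
        rw [← Finset.mul_sum]
        exact mul_le_mul_of_nonneg_left (sum_Ioc_inv_sq_le_sub hN2.ne' hK) (by positivity)
    _ ≤ 2 * |s| * (2 * x⁻¹) := by
        refine mul_le_mul_of_nonneg_left ?_ (by positivity)
        have h2 : (0 : ℝ) ≤ (K : ℝ)⁻¹ := by positivity
        have h3 : (N : ℝ)⁻¹ ≤ 2 * x⁻¹ := by
          rw [← div_eq_mul_inv, inv_eq_one_div, div_le_div_iff₀ hN0 hx0]
          linarith
        linarith
    _ = 4 * |s| * x⁻¹ := by ring

lemma mul_sum_primesBelow_eq {s : ℝ} (x : ℝ) :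
    -(1 / s) * (∑ p ∈ (⌊x⌋₊ + 1).primesBelow, Real.log |1 - s / (p : ℝ)|) -
        Real.log (Real.log x) =
      mertensDiff x + ∑ n ∈ Finset.range (⌊x⌋₊ + 1), factorRest s n := by
  have h : ∑ n ∈ Finset.Ioc 0 ⌊x⌋₊, primeInv n = ∑ n ∈ Finset.range (⌊x⌋₊ + 1), primeInv n := by
    refine Finset.sum_subset (fun n hn => ?_) fun n _ hn => ?_
    · simp only [Finset.mem_Ioc, Finset.mem_range] at hn ⊢
      omega
    · have : n = 0 := by
        simp only [Finset.mem_Ioc, Finset.mem_range] at *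
        omega
      simp [this, primeInv]
  unfold mertensDiff
  rw [h, Nat.primesBelow, Finset.sum_filter, Finset.mul_sum, sub_add_eq_add_sub,
    ← Finset.sum_add_distrib]
  congr 1
  refine Finset.sum_congr rfl fun n _ => ?_
  unfold primeInv factorRest
  split_ifs <;> ring

lemma factorRest_one : factorRest 1 = eulerRest 1 := by
  funext n
  unfold factorRest eulerRest
  simp only [Real.log_abs, Real.rpow_neg_one, one_div, div_one]
  split_ifs <;> simp

lemma inv_isBigO_log_rpow (t : ℝ) :
    (fun x : ℝ => x⁻¹) =O[atTop] fun x : ℝ => Real.log x ^ (-t) := by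
  have h := (isLittleO_log_rpow_rpow_atTop t one_pos).isBigO
  refine (h.inv_rev ?_).congr' ?_ ?_
  · filter_upwards [eventually_gt_atTop 1] with x hx h0
    exact absurd h0 (Real.rpow_pos_of_pos (Real.log_pos hx) t).ne'
  · filter_upwards with x
    rw [Real.rpow_one]
  · filter_upwards [eventually_gt_atTop 1] with x hx
    rw [Real.rpow_neg (Real.log_pos hx).le]

lemma inv_log_pow_isBigO_log_rpow {t : ℝ} {k : ℕ} (hk : t ≤ k) :
    (fun x : ℝ => (Real.log x ^ k)⁻¹) =O[atTop] fun x : ℝ => Real.log x ^ (-t) := by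
  refine Asymptotics.IsBigO.of_norm_eventuallyLE ?_
  filter_upwards [Real.tendsto_log_atTop.eventually_ge_atTop 1] with x hx
  have h0 : 0 ≤ Real.log x := by linarith
  rw [Real.norm_of_nonneg (by positivity), ← Real.rpow_natCast, ← Real.rpow_neg h0]
  exact Real.rpow_le_rpow_of_exponent_le hx (by linarith)

/-- For every real `s` not equal to `0` or a prime, there is a constant `G(s)` such that for
every real `t`, `−(1/s)·∑_{p ≤ x} log|1 − s/p| − log log x − G(s) = O((log x)^{−t})` as
`x → ∞`; moreover, `G(1) = γ`. -/
theorem mertens_constant_exists (s : ℝ) (hs0 : s ≠ 0) (hsp : ∀ p : ℕ, p.Prime → s ≠ (p : ℝ)) :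
    ∃ G : ℝ,
      (∀ t : ℝ,
        (fun x : ℝ =>
            -(1 / s) * (∑ p ∈ (⌊x⌋₊ + 1).primesBelow, Real.log |1 - s / (p : ℝ)|)
              - Real.log (Real.log x) - G)
          =O[atTop] fun x : ℝ => (Real.log x) ^ (-t)) ∧
      (s = 1 → G = Real.eulerMascheroniConstant) := by
  obtain ⟨M, hM⟩ := exists_mertensDiff_sub_isBigO
  have hMlim : Tendsto mertensDiff atTop (nhds M) := by
    have := ((hM 0).trans_tendsto (tendsto_inv_log_pow_succ 0)).add_const M
    simpa using this
  refine ⟨M + ∑' n, factorRest s n, fun t => ?_, fun h1 => ?_⟩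
  · obtain ⟨m, hm⟩ := exists_nat_ge t
    have h1 := (hM m).trans (inv_log_pow_isBigO_log_rpow (t := t) (k := m + 1) (by
      push_cast
      linarith))
    have h2 := (sum_factorRest_sub_tsum_isBigO hs0).trans (inv_isBigO_log_rpow t)
    refine (h1.add h2).congr_left fun x => ?_
    rw [mul_sum_primesBelow_eq]
    ring
  · subst h1
    rw [factorRest_one]
    exact mertens_limit_add_tsum_eulerRest hMlim
end

section
/- Let s be real with |s| ≤ 2, s ≠ 0, and s ≠ 2 (so that 1 − s/p > 0 for every prime p), and let M ∈ ℝ be such that ∑_{p ≤ x} 1/p − log log x → M as x → ∞ (M is the Meissel–Mertens constant). Then −(1/s)·∑_{p ≤ x} log(1 − s/p) − log log x → M + ∑_{n=1}^∞ (P(n+1)/(n+1))·s^n as x → ∞, where P(k) = ∑_p p^{−k} is the prime zeta function and the series ∑_{n=1}^∞ (P(n+1)/(n+1))·s^n converges absolutely for |s| < 2 and converges for |s| ≤ 2 with s ≠ 2. -/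
open Filter

/-- The prime zeta function `P(k) = ∑_p p^{−k}`, summed over all primes. -/
noncomputable def primeZeta (k : ℕ) : ℝ := ∑' p : Nat.Primes, 1 / ((p : ℕ) : ℝ) ^ k

open Topology in
/-- The Mercator series converges to `-log (1 - t)` on `[-1, 1)`. -/
theorem tendsto_sum_pow_div_neg_log_one_sub {t : ℝ} (ht : |t| ≤ 1) (ht1 : t ≠ 1) :
    Tendsto (fun N : ℕ => ∑ n ∈ Finset.range N, t ^ (n + 1) / ((n : ℝ) + 1)) atTop
      (𝓝 (-Real.log (1 - t))) := by
  rcases ht.lt_or_eq with h | h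
  · exact (Real.hasSum_pow_div_log_of_abs_lt_one h).tendsto_sum_nat
  obtain rfl : t = -1 := by
    rcases (abs_eq zero_le_one).1 h with h | h
    · exact absurd h ht1
    · exact h
  have hanti : Antitone fun n : ℕ => 1 / ((n : ℝ) + 1) := fun a b hab => by
    dsimp only
    gcongr
  obtain ⟨l, hl⟩ := hanti.tendsto_alternating_series_of_tendsto_zero
    tendsto_one_div_add_atTop_nhds_zero_nat
  have habel := Real.tendsto_tsum_powerSeries_nhdsWithin_lt hl
  have hid : Tendsto (fun x : ℝ => x) (𝓝[<] 1) (𝓝 1) := tendsto_nhdsWithin_of_tendsto_nhds tendsto_id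
  have hmul := hid.mul habel
  have hlog : Tendsto (fun x : ℝ => Real.log (1 + x)) (𝓝[<] 1) (𝓝 (Real.log (1 + 1))) :=
    (tendsto_const_nhds.add hid).log (by norm_num)
  have heq : (fun x : ℝ => x * ∑' n : ℕ, (-1) ^ n * (1 / ((n : ℝ) + 1)) * x ^ n) =ᶠ[𝓝[<] 1]
      fun x => Real.log (1 + x) := by
    filter_upwards [Ioo_mem_nhdsLT (show (0 : ℝ) < 1 by norm_num)] with x hx
    have hx' : |-x| < 1 := by rw [abs_neg, abs_of_pos hx.1]; exact hx.2
    have := (Real.hasSum_pow_div_log_of_abs_lt_one hx').tsum_eq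
    rw [sub_neg_eq_add] at this
    rw [← tsum_mul_left, ← neg_neg (Real.log _), ← this, ← tsum_neg]
    refine tsum_congr fun n => ?_
    rw [neg_pow x]
    ring
  have hval : l = Real.log (1 + 1) := by
    simpa using tendsto_nhds_unique (hmul.congr' heq) hlog
  rw [sub_neg_eq_add, ← hval]
  refine hl.neg.congr fun N => ?_
  rw [← Finset.sum_neg_distrib]
  refine Finset.sum_congr rfl fun n _ => ?_
  ring

open Topology in
/-- Expansion of `-(1/s) log (1 - s/a) - 1/a` in powers of `s`. -/
theorem tendsto_sum_pow_div_neg_log_one_sub_div {s a : ℝ} (hs0 : s ≠ 0) (ha : 0 < a)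
    (hsa : |s| ≤ a) (hne : s ≠ a) :
    Tendsto (fun N : ℕ => ∑ n ∈ Finset.range N, 1 / a ^ (n + 2) / ((n : ℝ) + 2) * s ^ (n + 1))
      atTop (𝓝 (-(1 / s) * Real.log (1 - s / a) - 1 / a)) := by
  have ht : |s / a| ≤ 1 := by
    rw [abs_div, abs_of_pos ha]
    exact (div_le_one ha).2 hsa
  have ht1 : s / a ≠ 1 := fun h => hne ((div_eq_one_iff_eq ha.ne').1 h)
  have h := (((tendsto_add_atTop_iff_nat 1).2
    (tendsto_sum_pow_div_neg_log_one_sub ht ht1)).const_mul (1 / s)).sub_const (1 / a)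
  have hlim : 1 / s * -Real.log (1 - s / a) - 1 / a = -(1 / s) * Real.log (1 - s / a) - 1 / a := by
    ring
  rw [hlim] at h
  refine h.congr fun N => ?_
  rw [Finset.sum_range_succ', mul_add, Finset.mul_sum]
  have h0 : 1 / s * ((s / a) ^ (0 + 1) / (((0 : ℕ) : ℝ) + 1)) = 1 / a := by
    push_cast
    field_simp
    norm_num
  rw [h0, add_sub_cancel_right]
  refine Finset.sum_congr rfl fun n _ => ?_
  push_cast
  rw [add_assoc (n : ℝ) 1 1, one_add_one_eq_two, div_pow]
  field_simp
  ring

/-- The double family underlying the series `∑ P(n+2) s^(n+1) / (n+2)`, restricted to the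
odd primes, is summable. -/
theorem summable_oddPrime_pow {s : ℝ} (hs : |s| ≤ 2) :
    Summable fun x : ℕ × ℕ => {p : ℕ | p.Prime ∧ p ≠ 2}.indicator
      (fun p => 1 / (p : ℝ) ^ (x.2 + 2) / ((x.2 : ℝ) + 2) * s ^ (x.2 + 1)) x.1 := by
  have hmaj : Summable fun x : ℕ × ℕ => 1 / (x.1 : ℝ) ^ 2 * (2 / 3 : ℝ) ^ x.2 :=
    (Real.summable_one_div_nat_pow.2 one_lt_two).mul_of_nonneg
      (summable_geometric_of_lt_one (by norm_num) (by norm_num))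
      (fun _ => by positivity) (fun _ => by positivity)
  refine hmaj.of_norm_bounded fun x => ?_
  obtain ⟨p, n⟩ := x
  by_cases hp : p ∈ {p : ℕ | p.Prime ∧ p ≠ 2}
  · rw [Set.indicator_of_mem hp]
    have hp3 : (3 : ℝ) ≤ p := by
      have := hp.1.two_le
      have := hp.2
      exact_mod_cast (show 3 ≤ p by omega)
    have hp0 : (0 : ℝ) < p := by linarith
    rw [norm_mul, norm_div, norm_div, norm_one, norm_pow, norm_pow, Real.norm_eq_abs s,
      Real.norm_of_nonneg hp0.le, Real.norm_of_nonneg (show (0 : ℝ) ≤ n + 2 by positivity)]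
    have hn : |s| / ((n : ℝ) + 2) ≤ 1 := by
      rw [div_le_one (by positivity)]
      have : (0 : ℝ) ≤ n := n.cast_nonneg
      linarith
    have hq : |s| / p ≤ 2 / 3 := by
      gcongr
    calc 1 / (p : ℝ) ^ (n + 2) / ((n : ℝ) + 2) * |s| ^ (n + 1)
        = 1 / (p : ℝ) ^ 2 * (|s| / p) ^ n * (|s| / ((n : ℝ) + 2)) := by
          rw [div_pow]
          field_simp
          ring
      _ ≤ 1 / (p : ℝ) ^ 2 * (2 / 3) ^ n * 1 := by gcongr
      _ = _ := mul_one _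
  · rw [Set.indicator_of_notMem hp, norm_zero]
    positivity

/-- Splitting off the prime `2` from the prime zeta function. -/
theorem primeZeta_eq_two_add_tsum {k : ℕ} (hk : 1 < k) :
    primeZeta k = 1 / 2 ^ k +
      ∑' p : ℕ, {p : ℕ | p.Prime ∧ p ≠ 2}.indicator (fun p => 1 / (p : ℝ) ^ k) p := by
  have hsum : Summable ({p : ℕ | p.Prime}.indicator fun p => 1 / (p : ℝ) ^ k) :=
    (Real.summable_one_div_nat_pow.2 hk).indicator _
  have h1 : primeZeta k = ∑' p : ℕ, {p : ℕ | p.Prime}.indicator (fun p => 1 / (p : ℝ) ^ k) p :=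
    tsum_subtype {p : ℕ | p.Prime} fun p => 1 / (p : ℝ) ^ k
  rw [h1, hsum.tsum_eq_add_tsum_ite 2, Set.indicator_of_mem (show 2 ∈ {p : ℕ | p.Prime} from
    Nat.prime_two)]
  congr 1
  refine tsum_congr fun p => ?_
  by_cases hp : p = 2 <;> simp [Set.indicator, hp]

/-- Let `s` be real with `|s| ≤ 2`, `s ≠ 0`, `s ≠ 2`, and let `M` be the Meissel–Mertens
constant, i.e. `∑_{p ≤ x} 1/p − log log x → M`.  Then the series
`∑_{n=1}^∞ (P(n+1)/(n+1))·s^n` converges (absolutely for `|s| < 2`), say to `L`, and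
`−(1/s)·∑_{p ≤ x} log(1 − s/p) − log log x → M + L` as `x → ∞`. -/
theorem mertens_constant_prime_zeta_series (s : ℝ) (hs : |s| ≤ 2) (hs0 : s ≠ 0) (hs2 : s ≠ 2)
    (M : ℝ)
    (hM : Tendsto
      (fun x : ℝ => (∑ p ∈ (⌊x⌋₊ + 1).primesBelow, 1 / (p : ℝ)) - Real.log (Real.log x))
      atTop (nhds M)) :
    (|s| < 2 → Summable (fun n : ℕ => primeZeta (n + 2) / ((n : ℝ) + 2) * s ^ (n + 1))) ∧
    ∃ L : ℝ,
      Tendsto (fun N : ℕ =>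
          ∑ n ∈ Finset.range N, primeZeta (n + 2) / ((n : ℝ) + 2) * s ^ (n + 1))
        atTop (nhds L) ∧
      Tendsto (fun x : ℝ =>
          -(1 / s) * (∑ p ∈ (⌊x⌋₊ + 1).primesBelow, Real.log (1 - s / (p : ℝ)))
            - Real.log (Real.log x))
        atTop (nhds (M + L)) := by
  set S : Set ℕ := {p : ℕ | p.Prime ∧ p ≠ 2} with hS
  set f : ℕ → ℕ → ℝ := fun p n =>
    S.indicator (fun p => 1 / (p : ℝ) ^ (n + 2) / ((n : ℝ) + 2) * s ^ (n + 1)) p with hf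
  set g : ℕ → ℝ := fun p => -(1 / s) * Real.log (1 - s / p) - 1 / (p : ℝ) with hg
  have hfs : Summable fun x : ℕ × ℕ => f x.1 x.2 := summable_oddPrime_pow hs
  have hcoeff : ∀ n : ℕ, primeZeta (n + 2) / ((n : ℝ) + 2) * s ^ (n + 1) =
      1 / (2 : ℝ) ^ (n + 2) / ((n : ℝ) + 2) * s ^ (n + 1) + ∑' p, f p n := fun n => by
    rw [primeZeta_eq_two_add_tsum (by omega), add_div, add_mul, ← tsum_div_const, ← tsum_mul_right]
    congr 1
    refine tsum_congr fun p => ?_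
    by_cases hp : p ∈ S <;> simp [hf, hp, ← hS]
  have hfswap : Summable fun x : ℕ × ℕ => f x.2 x.1 := hfs.prod_symm
  have hcols : HasSum (fun n => ∑' p, f p n) (∑' x : ℕ × ℕ, f x.1 x.2) := by
    rw [← (Equiv.prodComm ℕ ℕ).tsum_eq]
    exact hfswap.hasSum.prod_fiberwise fun n => (hfswap.prod_factor n).hasSum
  have hrow : ∀ p, HasSum (f p) (S.indicator g p) := fun p => by
    by_cases hp : p ∈ S
    · have hp3 : (3 : ℝ) ≤ p := by
        have := hp.1.two_le
        have := hp.2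
        exact_mod_cast (show 3 ≤ p by omega)
      have hsp : |s| < p := by linarith
      rw [(hfs.prod_factor p).hasSum_iff_tendsto_nat, Set.indicator_of_mem hp]
      simpa only [hf, Set.indicator_of_mem hp] using tendsto_sum_pow_div_neg_log_one_sub_div hs0
        (by linarith) hsp.le ((le_abs_self s).trans_lt hsp).ne
    · simpa only [hf, Set.indicator_of_notMem hp] using hasSum_zero
  have hrows : HasSum (S.indicator g) (∑' x : ℕ × ℕ, f x.1 x.2) :=
    hfs.hasSum.prod_fiberwise hrow
  refine ⟨fun hs' => ?_, g 2 + ∑' x : ℕ × ℕ, f x.1 x.2, ?_, ?_⟩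
  · simp_rw [hcoeff]
    refine Summable.add ?_ hcols.summable
    have hgeom := summable_geometric_of_lt_one (r := |s| / 2) (by positivity) (by linarith)
    refine hgeom.of_norm_bounded fun n => ?_
    rw [norm_mul, norm_div, norm_div, norm_one, norm_pow, norm_pow, Real.norm_eq_abs s,
      Real.norm_of_nonneg zero_le_two, Real.norm_of_nonneg (show (0 : ℝ) ≤ n + 2 by positivity)]
    have hn : |s| / (4 * ((n : ℝ) + 2)) ≤ 1 := by
      rw [div_le_one (by positivity)]
      have : (0 : ℝ) ≤ n := n.cast_nonneg
      linarith
    calc 1 / (2 : ℝ) ^ (n + 2) / ((n : ℝ) + 2) * |s| ^ (n + 1)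
        = (|s| / 2) ^ n * (|s| / (4 * ((n : ℝ) + 2))) := by
          rw [div_pow]
          field_simp
          ring
      _ ≤ (|s| / 2) ^ n * 1 := by gcongr
      _ = _ := mul_one _
  · simp_rw [hcoeff, Finset.sum_add_distrib]
    refine Tendsto.add ?_ hcols.tendsto_sum_nat
    simpa only [hg, Nat.cast_ofNat] using
      tendsto_sum_pow_div_neg_log_one_sub_div hs0 zero_lt_two hs hs2
  · have hfloor : Tendsto (fun x : ℝ => ⌊x⌋₊ + 1) atTop atTop :=
      (tendsto_add_atTop_nat 1).comp tendsto_nat_floor_atTop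
    refine (hM.add ((hrows.tendsto_sum_nat.comp hfloor).const_add (g 2))).congr' ?_
    filter_upwards [eventually_ge_atTop 2] with x hx
    have h2 : 2 ∈ (⌊x⌋₊ + 1).primesBelow :=
      Nat.mem_primesBelow.2 ⟨Nat.lt_succ_of_le (Nat.le_floor (by simpa using hx)), Nat.prime_two⟩
    have hodd : ∑ p ∈ Finset.range (⌊x⌋₊ + 1), S.indicator g p =
        ∑ p ∈ (⌊x⌋₊ + 1).primesBelow.erase 2, g p := by
      rw [Finset.sum_indicator_eq_sum_filter]
      refine Finset.sum_congr ?_ fun _ _ => rfl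
      ext p
      simp only [Finset.mem_filter, Finset.mem_range, Finset.mem_erase, Nat.mem_primesBelow, hS,
        Set.mem_ofPred_eq]
      tauto
    have hall : ∑ p ∈ (⌊x⌋₊ + 1).primesBelow, g p =
        -(1 / s) * (∑ p ∈ (⌊x⌋₊ + 1).primesBelow, Real.log (1 - s / (p : ℝ))) -
          ∑ p ∈ (⌊x⌋₊ + 1).primesBelow, 1 / (p : ℝ) := by
      rw [Finset.mul_sum, ← Finset.sum_sub_distrib]
    rw [Function.comp_apply, hodd, Finset.add_sum_erase _ _ h2, hall]
    ring
end

section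
/- Let P(k) = ∑_p p^{−k} denote the prime zeta function. The complex power series ∑_{n=0}^∞ (P(n+2)/(n+2))·s^n has radius of convergence 2; moreover, it converges at every s ∈ ℂ with |s| ≤ 2 and s ≠ 2, and it diverges at s = 2. -/
open Filter

theorem summable_primes_one_div_pow (n : ℕ) :
    Summable fun p : Nat.Primes => 1 / ((p : ℕ) : ℝ) ^ (n + 2) :=
  ((Real.summable_one_div_nat_pow (p := n + 2)).2 (by lia)).comp_injective
    Subtype.val_injective

theorem primeZeta_succ_le (n : ℕ) : primeZeta (n + 3) ≤ primeZeta (n + 2) / 2 := by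
  unfold primeZeta
  rw [← tsum_div_const]
  refine (summable_primes_one_div_pow (n + 1)).tsum_le_tsum (fun p => ?_)
    ((summable_primes_one_div_pow n).div_const 2)
  have hp : (2 : ℝ) ≤ ((p : ℕ) : ℝ) := by exact_mod_cast p.2.two_le
  rw [div_div]
  apply one_div_le_one_div_of_le (by positivity)
  rw [pow_succ _ (n + 2)]
  exact mul_le_mul_of_nonneg_left hp (by positivity)

theorem one_div_two_pow_le_primeZeta (n : ℕ) : 1 / (2 : ℝ) ^ (n + 2) ≤ primeZeta (n + 2) := by
  have h := (summable_primes_one_div_pow n).le_tsum ⟨2, Nat.prime_two⟩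
    (fun p _ => by positivity)
  simpa [primeZeta] using h

theorem antitone_two_pow_mul_primeZeta :
    Antitone fun n : ℕ => 2 ^ n * primeZeta (n + 2) := by
  refine antitone_nat_of_succ_le fun n => ?_
  have h := mul_le_mul_of_nonneg_left (primeZeta_succ_le n) (by positivity : (0 : ℝ) ≤ 2 ^ (n + 1))
  calc (2 : ℝ) ^ (n + 1) * primeZeta (n + 1 + 2)
      ≤ 2 ^ (n + 1) * (primeZeta (n + 2) / 2) := h
    _ = 2 ^ n * primeZeta (n + 2) := by ring

theorem one_fourth_le_two_pow_mul_primeZeta (n : ℕ) :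
    1 / 4 ≤ 2 ^ n * primeZeta (n + 2) := by
  have h := mul_le_mul_of_nonneg_left (one_div_two_pow_le_primeZeta n)
    (by positivity : (0 : ℝ) ≤ 2 ^ n)
  refine le_trans (le_of_eq ?_) h
  rw [pow_add]
  field_simp
  norm_num

theorem two_pow_mul_primeZeta_le (n : ℕ) : 2 ^ n * primeZeta (n + 2) ≤ primeZeta 2 := by
  simpa using antitone_two_pow_mul_primeZeta (Nat.zero_le n)

theorem antitone_two_pow_mul_primeZeta_div :
    Antitone fun n : ℕ => 2 ^ n * primeZeta (n + 2) / ((n : ℝ) + 2) := by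
  intro m n hmn
  have h := antitone_two_pow_mul_primeZeta hmn
  have h0 : 0 ≤ 2 ^ m * primeZeta (m + 2) := by
    linarith [one_fourth_le_two_pow_mul_primeZeta m]
  dsimp only at h ⊢
  gcongr

theorem tendsto_two_pow_mul_primeZeta_div :
    Tendsto (fun n : ℕ => 2 ^ n * primeZeta (n + 2) / ((n : ℝ) + 2)) atTop (nhds 0) := by
  have hlim : Tendsto (fun n : ℕ => primeZeta 2 / ((n : ℝ) + 2)) atTop (nhds 0) :=
    tendsto_const_nhds.div_atTop
      (tendsto_atTop_add_const_right _ _ tendsto_natCast_atTop_atTop)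
  refine squeeze_zero (fun n => ?_) (fun n => ?_) hlim
  · have := one_fourth_le_two_pow_mul_primeZeta n
    exact div_nonneg (by linarith) (by positivity)
  · have := two_pow_mul_primeZeta_le n
    gcongr

theorem primeZeta_term_eq (s : ℂ) (n : ℕ) :
    ((primeZeta (n + 2) / ((n : ℝ) + 2) : ℝ) : ℂ) * s ^ n =
      (2 ^ n * primeZeta (n + 2) / ((n : ℝ) + 2)) • (s / 2) ^ n := by
  rw [Complex.real_smul, div_pow]
  push_cast
  field_simp

theorem norm_primeZeta_term (s : ℂ) (n : ℕ) :
    ‖((primeZeta (n + 2) / ((n : ℝ) + 2) : ℝ) : ℂ) * s ^ n‖ =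
      2 ^ n * primeZeta (n + 2) / ((n : ℝ) + 2) * (‖s‖ / 2) ^ n := by
  have := one_fourth_le_two_pow_mul_primeZeta n
  rw [primeZeta_term_eq, norm_smul, norm_pow, norm_div s, Complex.norm_two,
    Real.norm_of_nonneg (div_nonneg (by linarith) (by positivity))]

theorem norm_geom_sum_le {z : ℂ} (hz : ‖z‖ ≤ 1) (hz1 : z ≠ 1) (n : ℕ) :
    ‖∑ i ∈ Finset.range n, z ^ i‖ ≤ 2 / ‖z - 1‖ := by
  rw [geom_sum_eq hz1, norm_div]
  gcongr
  calc ‖z ^ n - 1‖ ≤ ‖z ^ n‖ + ‖(1 : ℂ)‖ := norm_sub_le _ _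
    _ ≤ 1 + 1 := by
      rw [norm_pow, norm_one]
      gcongr
      exact pow_le_one₀ (norm_nonneg z) hz
    _ = 2 := by norm_num

theorem tendsto_zero_of_tendsto_sum_range {f : ℕ → ℂ} {L : ℂ}
    (h : Tendsto (fun N : ℕ => ∑ n ∈ Finset.range N, f n) atTop (nhds L)) :
    Tendsto f atTop (nhds 0) := by
  simpa [Finset.sum_range_succ] using ((tendsto_add_atTop_iff_nat 1).2 h).sub h

theorem not_summable_two_pow_mul_primeZeta_div :
    ¬ Summable fun n : ℕ => 2 ^ n * primeZeta (n + 2) / ((n : ℝ) + 2) := by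
  intro h
  refine Real.not_summable_one_div_natCast ((summable_nat_add_iff 2).1 ?_)
  refine Summable.of_nonneg_of_le (fun n => by positivity) (fun n => ?_) (h.mul_left 4)
  have := one_fourth_le_two_pow_mul_primeZeta n
  rw [← mul_div_assoc]
  push_cast
  gcongr
  linarith

/-- The complex power series `∑_{n=0}^∞ (P(n+2)/(n+2))·s^n` has radius of convergence `2`:
it converges absolutely for `‖s‖ < 2` and diverges for `‖s‖ > 2`; moreover it converges at
every `s` with `‖s‖ ≤ 2` and `s ≠ 2`, and diverges at `s = 2`. -/
theorem primeZeta_series_radius_two :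
    (∀ s : ℂ, ‖s‖ < 2 →
      Summable (fun n : ℕ => ((primeZeta (n + 2) / ((n : ℝ) + 2) : ℝ) : ℂ) * s ^ n)) ∧
    (∀ s : ℂ, 2 < ‖s‖ →
      ¬ ∃ L : ℂ, Tendsto (fun N : ℕ =>
          ∑ n ∈ Finset.range N, ((primeZeta (n + 2) / ((n : ℝ) + 2) : ℝ) : ℂ) * s ^ n)
        atTop (nhds L)) ∧
    (∀ s : ℂ, ‖s‖ ≤ 2 → s ≠ 2 →
      ∃ L : ℂ, Tendsto (fun N : ℕ =>
          ∑ n ∈ Finset.range N, ((primeZeta (n + 2) / ((n : ℝ) + 2) : ℝ) : ℂ) * s ^ n)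
        atTop (nhds L)) ∧
    ¬ ∃ L : ℂ, Tendsto (fun N : ℕ =>
        ∑ n ∈ Finset.range N, ((primeZeta (n + 2) / ((n : ℝ) + 2) : ℝ) : ℂ) * (2 : ℂ) ^ n)
      atTop (nhds L) := by
  refine ⟨fun s hs => ?_, fun s hs => ?_, fun s hs hs2 => ?_, ?_⟩
  · have hr : ‖s‖ / 2 < 1 := by linarith
    refine Summable.of_norm_bounded
      ((summable_geometric_of_lt_one (by positivity) hr).mul_left
        (2 ^ 0 * primeZeta (0 + 2) / (((0 : ℕ) : ℝ) + 2))) fun n => ?_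
    rw [norm_primeZeta_term]
    exact mul_le_mul_of_nonneg_right (antitone_two_pow_mul_primeZeta_div (Nat.zero_le n))
      (by positivity)
  · rintro ⟨L, hL⟩
    have hr : 1 < ‖s‖ / 2 := by linarith
    have h0 := (tendsto_zero_of_tendsto_sum_range hL).norm
    have h1 := (tendsto_pow_const_div_const_pow_of_one_lt 1 hr).add
      ((tendsto_pow_const_div_const_pow_of_one_lt 0 hr).const_mul 2)
    have h2 := h0.mul h1
    rw [norm_zero, zero_mul] at h2
    refine absurd (ge_of_tendsto' h2 fun n => ?_) (by norm_num : ¬ (1 / 4 : ℝ) ≤ 0)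
    refine (one_fourth_le_two_pow_mul_primeZeta n).trans_eq ?_
    have hpos : (‖s‖ / 2) ^ n ≠ 0 := by positivity
    rw [norm_primeZeta_term]
    generalize (‖s‖ / 2) ^ n = r at hpos
    field_simp
  · have hz : ‖s / 2‖ ≤ 1 := by
      rw [norm_div, Complex.norm_two]
      linarith
    have hz1 : s / 2 ≠ 1 := fun h => hs2 (by simpa using (div_eq_iff two_ne_zero).1 h)
    simp only [primeZeta_term_eq]
    exact cauchySeq_tendsto_of_complete
      (antitone_two_pow_mul_primeZeta_div.cauchySeq_series_mul_of_tendsto_zero_of_bounded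
        tendsto_two_pow_mul_primeZeta_div (norm_geom_sum_le hz hz1))
  · rintro ⟨L, hL⟩
    refine not_summable_two_pow_mul_primeZeta_div
      ((hasSum_iff_tendsto_nat_of_nonneg (fun n => ?_) L.re).2 ?_).summable
    · have := one_fourth_le_two_pow_mul_primeZeta n
      exact div_nonneg (by linarith) (by positivity)
    · refine ((Complex.continuous_re.tendsto L).comp hL).congr fun N => ?_
      simp [primeZeta_term_eq, -Complex.ofReal_div]
end
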